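/- For any partitions λ, μ and integers e, f: P_{λ,μ}(e+1, f) − P_{λ,μ}(e, f) = ∑_{θ} P_{λ,θ}(e, f), where the sum is over partitions θ ≠ μ obtained from μ by removing a nonempty vertical strip (i.e. μ/θ has at most one box in each row). -/

import Mathlib

open scoped Classical BigOperators
noncomputable section

namespace ChernTensor

/-- The rectangular Young diagram with `r` rows each of length `c`. -/
def rect (r c : ℕ) : YoungDiagram :=
  ⟨Finset.range r ×ˢ Finset.range c, by
    intro p q hle hp
    simp only [Finset.coe_product, Set.mem_prod, Finset.mem_coe, Finset.mem_range] at hp ⊢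
    exact ⟨lt_of_le_of_lt hle.1 hp.1, lt_of_le_of_lt hle.2 hp.2⟩⟩

/-- The complement of a diagram `d` (rotated by 180°) inside the rectangle
with `r` rows and `c` columns. -/
def complIn (r c : ℕ) (d : YoungDiagram) : YoungDiagram :=
  ⟨(Finset.range r ×ˢ Finset.range c).filter
      (fun p => (r - 1 - p.1, c - 1 - p.2) ∉ d), by
    intro p q hle hp
    simp only [Finset.coe_filter, Set.mem_setOf_eq, Finset.mem_product,
      Finset.mem_range] at hp ⊢
    refine ⟨⟨lt_of_le_of_lt hle.1 hp.1.1, lt_of_le_of_lt hle.2 hp.1.2⟩, fun hq => hp.2 ?_⟩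
    exact d.isLowerSet (Prod.mk_le_mk.mpr ⟨Nat.sub_le_sub_left hle.1 _,
      Nat.sub_le_sub_left hle.2 _⟩) hq⟩

/-- The complement `e×f − ν̃ = (e − ν*_f, …, e − ν*_1)` of `ν` in the rectangle
with `f` rows each of length `e` (the paper's `e×f`). -/
def rectCompl (e f : ℕ) (ν : YoungDiagram) : YoungDiagram :=
  complIn f e ν.transpose

/-- The product of the hook lengths of all boxes of a Young diagram, as a rational. -/
def hookProd (ν : YoungDiagram) : ℚ :=
  ∏ c ∈ ν.cells, ((ν.rowLen c.1 + ν.colLen c.2 - c.1 - c.2 - 1 : ℕ) : ℚ)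

/-- The content polynomial `(n | ρ) = ∏_{(i,j) ∈ ρ} (n + j − i)` evaluated at `n`. -/
def contPoly (n : ℚ) (ρ : YoungDiagram) : ℚ :=
  ∏ c ∈ ρ.cells, (n + (c.2 : ℚ) - (c.1 : ℚ))

/-- The skew content polynomial `(n | ρ − σ) = ∏_{(i,j) ∈ ρ/σ} (n + j − i)`. -/
def skewContPoly (n : ℚ) (ρ σ : YoungDiagram) : ℚ :=
  ∏ c ∈ ρ.cells \ σ.cells, (n + (c.2 : ℚ) - (c.1 : ℚ))

/-- `T : ℕ×ℕ → ℕ` is a Littlewood–Richardson skew tableau of shape `ν/λ` and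
content `μ`: entries (≥ 1) exactly on the skew cells, rows weakly increasing,
columns strictly increasing, exactly `μ_k` entries equal to `k` (1-indexed),
and the reverse reading word is a lattice word. -/
def IsLRTableau (lam mu nu : YoungDiagram) (T : ℕ × ℕ → ℕ) : Prop :=
  (∀ c : ℕ × ℕ, c ∈ nu.cells \ lam.cells ↔ T c ≠ 0) ∧
  (∀ i j j', j ≤ j' → (i, j) ∈ nu.cells \ lam.cells → (i, j') ∈ nu.cells \ lam.cells →
    T (i, j) ≤ T (i, j')) ∧
  (∀ i i' j, i < i' → (i, j) ∈ nu.cells \ lam.cells → (i', j) ∈ nu.cells \ lam.cells →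
    T (i, j) < T (i', j)) ∧
  (∀ k : ℕ, ((nu.cells \ lam.cells).filter (fun c => T c = k + 1)).card = mu.rowLen k) ∧
  (∀ c ∈ nu.cells \ lam.cells, ∀ k : ℕ,
    (((nu.cells \ lam.cells).filter
        (fun d => (d.1 < c.1 ∨ (d.1 = c.1 ∧ c.2 ≤ d.2)) ∧ T d = k + 2)).card ≤
     ((nu.cells \ lam.cells).filter
        (fun d => (d.1 < c.1 ∨ (d.1 = c.1 ∧ c.2 ≤ d.2)) ∧ T d = k + 1)).card))

/-- The Littlewood–Richardson coefficient `c^ν_{λμ}`, defined as the number of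
Littlewood–Richardson skew tableaux of shape `ν/λ` and content `μ`. -/
def lrCoeff (lam mu nu : YoungDiagram) : ℕ :=
  if lam ≤ nu then Nat.card {T : ℕ × ℕ → ℕ // IsLRTableau lam mu nu T} else 0

/-- The universal coefficient `P_{λ,μ}(e,f) = ∑_ν c^{ν*}_{λ*,μ} (e|ν−λ)(f|ν*−μ)/h(ν)`. -/
def P (lam mu : YoungDiagram) (e f : ℚ) : ℚ :=
  ∑ᶠ nu : YoungDiagram, (lrCoeff lam.transpose mu nu.transpose : ℚ) *
    skewContPoly e nu lam * skewContPoly f nu.transpose mu / hookProd nu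

/-- A semistandard filling of the cells of `lam` with values in `Fin n`:
weakly increasing along rows, strictly increasing down columns. -/
def IsSSYT (lam : YoungDiagram) {n : ℕ} (T : lam.cells → Fin n) : Prop :=
  (∀ a b : lam.cells, (a : ℕ × ℕ).1 = (b : ℕ × ℕ).1 → (a : ℕ × ℕ).2 ≤ (b : ℕ × ℕ).2 →
    T a ≤ T b) ∧
  (∀ a b : lam.cells, (a : ℕ × ℕ).2 = (b : ℕ × ℕ).2 → (a : ℕ × ℕ).1 < (b : ℕ × ℕ).1 →
    T a < T b)

/-- The Schur polynomial `s_λ(x₁,…,x_n)` evaluated at `x`, as the generating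
function of semistandard tableaux. -/
def schur (lam : YoungDiagram) {n : ℕ} (x : Fin n → ℚ) : ℚ :=
  ∑ᶠ T : {T : lam.cells → Fin n // IsSSYT lam T}, ∏ c : lam.cells, x (T.1 c)

/-- The generalized binomial coefficient `C(a, b) = a(a−1)⋯(a−b+1)/b!`. -/
def gbinom (a : ℚ) (b : ℕ) : ℚ :=
  (∏ i ∈ Finset.range b, (a - i)) / (Nat.factorial b : ℚ)

/-! ### Bialternants and Gelfand–Tsetlin patterns -/

/-- Expansion of the bialternant `det (x i ^ (m (n - j) + j))` in `n + 1` variables along its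
last variable. -/
lemma det_alt_succ {R : Type*} [CommRing R] (n : ℕ) (x : ℕ → R) (m : ℕ → ℕ) (hm : Antitone m) :
    (Matrix.of fun i j : Fin (n + 1) => x i ^ (m (n - j) + j)).det =
      (∏ i : Fin n, (x n - x i)) *
        ∑ r ∈ Fintype.piFinset (fun j : Fin n => Finset.Icc (m (n - j)) (m (n - 1 - j))),
          x n ^ (m n + ∑ j : Fin n, (m (n - 1 - j) - r j)) *
            (Matrix.of fun i j : Fin n => x i ^ (r j + j)).det := by
  set y := x n with hy
  have key : ∀ (a : R) (p q j : ℕ), q ≤ p →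
      a ^ (p + (j + 1)) - y ^ (p - q + 1) * a ^ (q + j) =
        (a - y) * ∑ s ∈ Finset.Icc q p, y ^ (p - s) * a ^ (s + j) := by
    intro a p q j hqp
    have h1 : ∑ s ∈ Finset.Icc q p, y ^ (p - s) * a ^ (s + j) =
        a ^ (q + j) * ∑ s ∈ Finset.range (p - q + 1), a ^ s * y ^ (p - q + 1 - 1 - s) := by
      rw [Finset.mul_sum]
      refine (Finset.sum_bij' (fun s _ => q + s) (fun s _ => s - q) ?_ ?_ ?_ ?_ ?_).symm
      · intro s hs; simp at hs ⊢; omega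
      · intro s hs; simp at hs ⊢; omega
      · intro s hs; simp
      · intro s hs; simp at hs ⊢; omega
      · intro s hs
        have : p - (q + s) = p - q + 1 - 1 - s := by omega
        rw [this]; ring
    rw [h1, ← mul_assoc, mul_comm (a - y), mul_assoc, mul_comm (a - y), geom_sum₂_mul, mul_sub,
      ← pow_add, mul_comm (y ^ _)]
    congr 2
    omega
  let B : Matrix (Fin (n + 1)) (Fin (n + 1)) R := Matrix.of fun i j =>
    Fin.cases (x i ^ (m n)) (fun j : Fin n =>
      (x i - y) * ∑ s ∈ Finset.Icc (m (n - j)) (m (n - 1 - j)),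
        y ^ (m (n - 1 - j) - s) * x i ^ (s + j)) j
  rw [Matrix.det_eq_of_forall_col_eq_smul_add_pred (B := B)
    (fun j : Fin n => y ^ (m (n - 1 - j) - m (n - j) + 1))]
  rotate_left
  · intro i; simp [B]
  · intro i j
    have h := key (x i) (m (n - 1 - j)) (m (n - j)) j (hm (by omega))
    have e : n - (↑j + 1) = n - 1 - (j : ℕ) := by omega
    simp only [Matrix.of_apply, Fin.val_succ, Fin.val_castSucc, B, Fin.cases_succ, ← h, e]
    ring
  rw [Matrix.det_succ_row B (Fin.last n), Finset.sum_eq_single 0]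
  rotate_left
  · intro j _ hj
    obtain ⟨j, rfl⟩ := Fin.exists_succ_eq.mpr hj
    simp [B, hy]
  · simp
  have hsub : (B.submatrix (Fin.last n).succAbove (0 : Fin (n + 1)).succAbove).det =
      (∏ i : Fin n, (x i - y)) * ∑ r ∈ Fintype.piFinset
          (fun j : Fin n => Finset.Icc (m (n - j)) (m (n - 1 - j))),
          y ^ (∑ j : Fin n, (m (n - 1 - j) - r j)) *
            (Matrix.of fun i j : Fin n => x i ^ (r j + j)).det := by
    have : B.submatrix (Fin.last n).succAbove (0 : Fin (n + 1)).succAbove =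
        Matrix.of fun i j : Fin n => (x i - y) * (Matrix.of (fun i j : Fin n =>
          ∑ s ∈ Finset.Icc (m (n - j)) (m (n - 1 - j)),
            y ^ (m (n - 1 - j) - s) * x i ^ (s + j))) i j := by
      ext i j; simp [B]
    rw [this, Matrix.det_mul_column]
    congr 1
    rw [← Matrix.det_transpose]
    have h2 : (Matrix.of (fun i j : Fin n =>
          ∑ s ∈ Finset.Icc (m (n - j)) (m (n - 1 - j)),
            y ^ (m (n - 1 - j) - s) * x i ^ (s + j))).transpose =
        fun j : Fin n => ∑ s ∈ Finset.Icc (m (n - j)) (m (n - 1 - j)),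
          fun i : Fin n => y ^ (m (n - 1 - j) - s) * x i ^ (s + j) := by
      ext j i; simp [Finset.sum_apply]
    have h3 := (Matrix.detRowAlternating (n := Fin n) (R := R)).toMultilinearMap.map_sum_finset
      (fun (j : Fin n) (s : ℕ) => fun i : Fin n => y ^ (m (n - 1 - j) - s) * x i ^ (s + j))
      (fun j : Fin n => Finset.Icc (m (n - j)) (m (n - 1 - j)))
    rw [h2]
    refine h3.trans (Finset.sum_congr rfl fun r _ => ?_)
    rw [← Finset.prod_pow_eq_pow_sum, ← Matrix.det_transpose]
    exact Matrix.det_mul_column (fun j : Fin n => y ^ (m (n - 1 - j) - r j))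
      (Matrix.of fun i j : Fin n => x i ^ (r j + j)).transpose
  rw [hsub]
  have hs : ∏ i : Fin n, (x i - y) = (-1) ^ n * ∏ i : Fin n, (y - x i) := by
    have : ∀ i : Fin n, x i - y = (-1) * (y - x i) := fun i => by ring
    rw [Finset.prod_congr rfl fun i _ => this i, Finset.prod_mul_distrib, Fin.prod_const]
  have hB : B (Fin.last n) 0 = y ^ m n := by simp [B, hy]
  rw [hs, hB]
  simp only [Fin.val_last, Fin.val_zero, add_zero, pow_add _ (m n), mul_assoc, ← Finset.mul_sum]
  generalize ∑ r ∈ Fintype.piFinset (fun j : Fin n => Finset.Icc (m (n - j)) (m (n - 1 - j))),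
    y ^ (∑ j : Fin n, (m (n - 1 - j) - r j)) *
      (Matrix.of fun i j : Fin n => x i ^ (r j + j)).det = S
  have h1 : ((-1 : R) ^ n) * (-1) ^ n = 1 := by rw [← mul_pow]; simp
  linear_combination (y ^ m n * (∏ i : Fin n, (y - x i)) * S) * h1

/-- A Gelfand–Tsetlin pattern with `n` nontrivial rows and top row `m`: a chain of
interlacing sequences from `0` to `m`, continued by `m` from the `n`-th step on. -/
def IsGT (n : ℕ) (m : ℕ → ℕ) (t : ℕ → ℕ → ℕ) : Prop :=
  t 0 = 0 ∧ (∀ i, n ≤ i → t i = m) ∧ ∀ i k, t i k ≤ t (i + 1) k ∧ t (i + 1) (k + 1) ≤ t i k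

namespace IsGT

variable {n : ℕ} {m : ℕ → ℕ} {t : ℕ → ℕ → ℕ}

lemma mono (h : IsGT n m t) (k : ℕ) : Monotone fun i => t i k :=
  monotone_nat_of_le_succ fun i => (h.2.2 i k).1

lemma eq_zero (h : IsGT n m t) : ∀ {i k : ℕ}, i ≤ k → t i k = 0
  | 0, k, _ => by simp [h.1]
  | i + 1, k + 1, hik => Nat.le_zero.mp ((h.2.2 i k).2.trans (h.eq_zero (by omega)).le)

lemma le (h : IsGT n m t) (i k : ℕ) : t i k ≤ m k := by
  rw [← h.2.1 (max i n) (le_max_right _ _)]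
  exact h.mono k (le_max_left _ _)

lemma antitone (h : IsGT n m t) (i : ℕ) : Antitone (t i) :=
  antitone_nat_of_succ_le fun k => (h.2.2 i (k + 1)).1.trans (h.2.2 i k).2

lemma antitone_top (h : IsGT n m t) : Antitone m := h.2.1 n le_rfl ▸ h.antitone n

end IsGT

lemma finite_isGT (n : ℕ) (m : ℕ → ℕ) : {t | IsGT n m t}.Finite := by
  let φ : (Fin n → Fin n → Fin (m 0 + 1)) → (ℕ → ℕ → ℕ) := fun s i k =>
    if hi : i < n then if hk : k < n then s ⟨i, hi⟩ ⟨k, hk⟩ else 0 else m k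
  refine (Set.finite_range φ).subset ?_
  intro t ht
  refine ⟨fun i k => ⟨t i k, Nat.lt_succ_of_le ((ht.le i k).trans (ht.antitone_top k.val.zero_le))⟩, ?_⟩
  ext i k
  simp only [φ]
  split_ifs with hi hk
  · rfl
  · exact (ht.eq_zero (by omega)).symm
  · rw [ht.2.1 i (by omega)]

/-- The finite set of Gelfand–Tsetlin patterns with `n` nontrivial rows and top row `m`. -/
def gtSet (n : ℕ) (m : ℕ → ℕ) : Finset (ℕ → ℕ → ℕ) := (finite_isGT n m).toFinset

@[simp] lemma mem_gtSet {n : ℕ} {m : ℕ → ℕ} {t : ℕ → ℕ → ℕ} : t ∈ gtSet n m ↔ IsGT n m t := by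
  simp [gtSet]

/-- The sum of the first `k` entries of the `i`-th row of a pattern. -/
def psum (t : ℕ → ℕ → ℕ) (i k : ℕ) : ℕ := ∑ j ∈ Finset.range k, t i j

lemma psum_succ (t : ℕ → ℕ → ℕ) (i k : ℕ) : psum t i (k + 1) = psum t i k + t i k :=
  Finset.sum_range_succ _ _

/-- The `i`-th component of the weight of a pattern. -/
def wt (t : ℕ → ℕ → ℕ) (i : ℕ) : ℕ := psum t (i + 1) (i + 1) - psum t i i

namespace IsGT

variable {n : ℕ} {m : ℕ → ℕ} {t : ℕ → ℕ → ℕ}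

lemma psum_eq (h : IsGT n m t) {i K : ℕ} (hK : i ≤ K) : psum t i K = psum t i i := by
  obtain ⟨d, rfl⟩ := Nat.exists_eq_add_of_le hK
  induction d with
  | zero => rfl
  | succ d ih => rw [← add_assoc, psum_succ, ih (by omega), h.eq_zero (by omega), add_zero]

lemma psum_le (h : IsGT n m t) (i k : ℕ) : psum t i k ≤ psum t (i + 1) k :=
  Finset.sum_le_sum fun j _ => (h.2.2 i j).1

lemma psum_add_wt (h : IsGT n m t) {i K : ℕ} (hK : i + 1 ≤ K) :
    psum t i K + wt t i = psum t (i + 1) K := by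
  have h1 := h.psum_le i (i + 1)
  rw [wt, h.psum_eq hK, h.psum_eq (by omega : i ≤ K)]
  rw [h.psum_eq (by omega : i ≤ i + 1)] at h1
  omega

lemma sum_wt (h : IsGT n m t) : ∀ k : ℕ, ∑ i ∈ Finset.range k, wt t i = psum t k k
  | 0 => rfl
  | k + 1 => by
    rw [Finset.sum_range_succ, h.sum_wt k, ← h.psum_add_wt le_rfl, h.psum_eq (Nat.le_succ k)]

end IsGT

/-- The bialternant of `m` is the generating function of the patterns with top row `m` times
the Vandermonde determinant. -/
lemma det_alt_eq_sum {R : Type*} [CommRing R] (x : ℕ → R) : ∀ (n : ℕ) (m : ℕ → ℕ),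
    Antitone m → (∀ k, n ≤ k → m k = 0) →
    (Matrix.of fun i j : Fin n => x i ^ (m (n - 1 - j) + j)).det =
      (∑ t ∈ gtSet n m, ∏ i ∈ Finset.range n, x i ^ wt t i) *
        (Matrix.of fun i j : Fin n => x i ^ (j : ℕ)).det
  | 0, m, _, hm0 => by
    have h0 : m = 0 := funext fun k => hm0 k k.zero_le
    have : gtSet 0 m = {fun _ => 0} := by
      ext t
      simp only [mem_gtSet, Finset.mem_singleton]
      constructor
      · intro h; funext i; rw [h.2.1 i i.zero_le, h0]
      · rintro rfl
        exact ⟨rfl, fun i _ => h0.symm, fun i k => by simp⟩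
    simp [this]
  | n + 1, m, hm, hm0 => by
    have hV : (Matrix.of fun i j : Fin (n + 1) => x i ^ (j : ℕ)).det =
        (∏ i : Fin n, (x n - x i)) * (Matrix.of fun i j : Fin n => x i ^ (j : ℕ)).det := by
      have h := det_alt_succ n x 0 antitone_const
      have h1 : Fintype.piFinset (fun _ : Fin n => Finset.Icc 0 0) = {(fun _ => 0)} := by
        ext r
        simp [funext_iff]
      simp only [Pi.zero_apply, zero_add, h1, Finset.sum_singleton] at h
      simpa using h
    have h := det_alt_succ n x m hm
    simp only [Nat.add_sub_cancel]
    rw [h, hV, ← mul_assoc, mul_comm (Finset.sum _ _), mul_assoc]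
    congr 1
    let ext : (Fin n → ℕ) → ℕ → ℕ := fun r k => if hk : k < n then r ⟨n - 1 - k, by omega⟩ else 0
    have ext_apply : ∀ r (j : Fin n), ext r (n - 1 - j) = r j := by
      intro r j
      have : n - 1 - (j : ℕ) < n := by omega
      simp only [ext, this, dif_pos]
      congr 1; ext; simp; omega
    set I := Fintype.piFinset (fun j : Fin n => Finset.Icc (m (n - j)) (m (n - 1 - j))) with hI
    have hIext : ∀ r ∈ I, ∀ k, m (k + 1) ≤ ext r k ∧ ext r k ≤ m k := by
      intro r hr k
      by_cases hk : k < n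
      · have := Fintype.mem_piFinset.mp hr ⟨n - 1 - k, by omega⟩
        simp only [Finset.mem_Icc] at this
        simp only [ext, hk, dif_pos]
        have e1 : n - (n - 1 - k) = k + 1 := by omega
        have e2 : n - 1 - (n - 1 - k) = k := by omega
        rwa [e1, e2] at this
      · simp only [ext, hk, dif_neg, not_false_eq_true]
        exact ⟨(hm0 _ (by omega)).le, Nat.zero_le _⟩
    have ih : ∀ r ∈ I, (Matrix.of fun i j : Fin n => x i ^ (r j + j)).det =
        (∑ t ∈ gtSet n (ext r), ∏ i ∈ Finset.range n, x i ^ wt t i) *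
        (Matrix.of fun i j : Fin n => x i ^ (j : ℕ)).det := by
      intro r hr
      have := det_alt_eq_sum x n (ext r)
        (antitone_nat_of_succ_le fun k => (hIext r hr (k + 1)).2.trans (hIext r hr k).1)
        (fun k hk => by simp [ext, not_lt.mpr hk])
      simpa only [ext_apply] using this
    rw [Finset.sum_congr rfl fun r hr => by rw [ih r hr, ← mul_assoc, Finset.mul_sum],
      ← Finset.sum_mul, Finset.sum_sigma']
    congr 1
    have ext_inj : ∀ t, IsGT (n + 1) m t → ext (fun j => t n (n - 1 - j)) = t n := by
      intro t ht
      funext k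
      by_cases hk : k < n
      · simp only [ext, hk, dif_pos]
        congr 1; omega
      · simp only [ext, hk, dif_neg, not_false_eq_true]
        exact (ht.eq_zero (by omega)).symm
    refine Finset.sum_bij' (fun p _ => fun i => if i ≤ n then p.2 i else m)
      (fun t _ => ⟨fun j => t n (n - 1 - j), fun i => if i ≤ n then t i else t n⟩) ?_ ?_ ?_ ?_ ?_
    · rintro ⟨r, t⟩ hp
      simp only [Finset.mem_sigma, mem_gtSet] at hp ⊢
      obtain ⟨hr, ht⟩ := hp
      refine ⟨by simp [ht.1], fun i hi => by simp [show ¬ i ≤ n by omega], fun i k => ?_⟩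
      rcases lt_trichotomy i n with h | rfl | h
      · simp only [h.le, if_true, Nat.succ_le_of_lt h]; exact ht.2.2 i k
      · simp only [le_refl, if_true, Nat.not_succ_le_self, if_false, ht.2.1 i le_rfl]
        exact ⟨(hIext r hr k).2, (hIext r hr k).1⟩
      · simp only [not_le.mpr h, if_false, show ¬ i + 1 ≤ n by omega]
        exact ⟨le_rfl, hm (Nat.le_succ k)⟩
    · intro t ht
      simp only [Finset.mem_sigma, mem_gtSet] at ht ⊢
      have hn : t (n + 1) = m := ht.2.1 _ le_rfl
      refine ⟨?_, by simp [ht.1], fun i hi => ?_, fun i k => ?_⟩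
      · rw [hI, Fintype.mem_piFinset]
        intro j
        simp only [Finset.mem_Icc]
        rw [← hn]
        refine ⟨?_, (ht.2.2 _ _).1⟩
        have : n - (j : ℕ) = n - 1 - j + 1 := by omega
        rw [this]
        exact (ht.2.2 _ _).2
      · rw [ext_inj t ht]
        rcases hi.lt_or_eq with h | rfl
        · simp [not_le.mpr h]
        · simp
      · rcases lt_or_ge i n with h | h
        · simp only [h.le, if_true, Nat.succ_le_of_lt h]; exact ht.2.2 i k
        · rcases h.lt_or_eq with h | rfl
          · simp only [not_le.mpr h, if_false, show ¬ i + 1 ≤ n by omega]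
            exact ⟨le_rfl, ht.antitone n (Nat.le_succ k)⟩
          · simp only [le_refl, if_true, Nat.not_succ_le_self, if_false]
            exact ⟨trivial, ht.antitone _ (Nat.le_succ k)⟩
    · rintro ⟨r, t⟩ hp
      simp only [Finset.mem_sigma, mem_gtSet] at hp
      obtain ⟨hr, ht⟩ := hp
      have e1 : (fun j : Fin n => t n (n - 1 - j)) = r := by
        funext j
        rw [ht.2.1 n le_rfl, ext_apply]
      have e2 : (fun i => if i ≤ n then (if i ≤ n then t i else m) else t n) = t := by
        funext i
        split_ifs with h
        · rfl
        · rw [ht.2.1 n le_rfl, ht.2.1 i (by omega)]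
      simp [e1]
      exact e2
    · intro t ht
      rw [mem_gtSet] at ht
      funext i
      dsimp only
      split_ifs with h
      · rfl
      · exact (ht.2.1 i (by omega)).symm
    · rintro ⟨r, t⟩ hp
      simp only [Finset.mem_sigma, mem_gtSet] at hp
      obtain ⟨hr, ht⟩ := hp
      rw [Finset.prod_range_succ, mul_comm]
      congr 1
      · refine Finset.prod_congr rfl fun i hi => ?_
        have hi' : i < n := Finset.mem_range.mp hi
        simp [wt, psum, hi'.le, Nat.succ_le_of_lt hi']
      · congr 1
        simp only [wt, psum, le_refl, if_true, Nat.not_succ_le_self, if_false]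
        rw [Finset.sum_range_succ, ht.2.1 n le_rfl, add_comm]
        have h1 : ∑ j ∈ Finset.range n, m j = ∑ j : Fin n, m (n - 1 - j) := by
          rw [← Finset.sum_range_reflect, Finset.sum_range]
        have h2 : ∑ j ∈ Finset.range n, ext r j = ∑ j : Fin n, r j := by
          rw [← Finset.sum_range_reflect, Finset.sum_range]
          exact Finset.sum_congr rfl fun j _ => ext_apply r j
        have hle : ∀ j : Fin n, r j ≤ m (n - 1 - j) := fun j =>
          (Finset.mem_Icc.mp (Fintype.mem_piFinset.mp hr j)).2
        rw [h1, h2, Finset.sum_tsub_distrib _ (fun j _ => hle j)]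
        have := Finset.sum_le_sum (fun j (_ : j ∈ Finset.univ) => hle j)
        omega

/-- A Hankel-type determinant, expanded along the patterns with top row `m`. -/
lemma det_hankel_eq_sum (B : ℕ → ℚ) (n : ℕ) (m u : ℕ → ℕ) (hm : Antitone m)
    (hm0 : ∀ k, n ≤ k → m k = 0) :
    (Matrix.of fun i j : Fin n => B (u i + (m (n - 1 - j) + j))).det =
      ∑ t ∈ gtSet n m, (Matrix.of fun i j : Fin n => B (u i + wt t i + j)).det := by
  let x : ℕ → MvPolynomial (Fin n) ℚ := fun i => if h : i < n then MvPolynomial.X ⟨i, h⟩ else 0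
  have hx : ∀ i : Fin n, x i = MvPolynomial.X i := fun i => by simp [x]
  let L : MvPolynomial (Fin n) ℚ →ₗ[ℚ] ℚ :=
    (MvPolynomial.basisMonomials (Fin n) ℚ).constr ℚ (fun s => ∏ i, B (s i))
  have hL : ∀ v : Fin n → ℕ, L (∏ i : Fin n, x i ^ v i) = ∏ i, B (v i) := by
    intro v
    have h1 : ∏ i : Fin n, x i ^ v i =
        MvPolynomial.basisMonomials (Fin n) ℚ (Finsupp.equivFunOnFinite.symm v) := by
      rw [MvPolynomial.coe_basisMonomials]
      beta_reduce
      rw [MvPolynomial.monomial_eq, Finsupp.prod_fintype]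
      · simp [hx]
      · simp
    rw [h1, Module.Basis.constr_basis]
    simp
  have hdet : ∀ v e : Fin n → ℕ,
      L ((∏ i : Fin n, x i ^ v i) * (Matrix.of fun i j : Fin n => x i ^ e j).det) =
        (Matrix.of fun i j : Fin n => B (v i + e j)).det := by
    intro v e
    rw [← Matrix.det_transpose, Matrix.det_apply, ← Matrix.det_transpose, Matrix.det_apply,
      Finset.mul_sum, map_sum]
    refine Finset.sum_congr rfl fun σ _ => ?_
    rw [mul_smul_comm, Units.smul_def, Units.smul_def, map_zsmul]
    congr 1
    simp only [Matrix.transpose_apply, Matrix.of_apply]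
    rw [← Finset.prod_mul_distrib, ← hL]
    simp only [pow_add]
  have h := congrArg (fun p => L ((∏ i : Fin n, x i ^ u i) * p)) (det_alt_eq_sum x n m hm hm0)
  beta_reduce at h
  rw [hdet (fun i => u i) (fun j => m (n - 1 - j) + j), Finset.sum_mul, Finset.mul_sum,
    map_sum] at h
  rw [h]
  refine Finset.sum_congr rfl fun t _ => ?_
  rw [← hdet (fun i => u i + wt t i) (fun j => j), ← mul_assoc, Finset.prod_range,
    ← Finset.prod_mul_distrib]
  simp only [pow_add]

/-! ### The sign-reversing involution -/

/-- Toggle of the middle row `Y` of an interlacing triple `X`, `Y`, `Z` from position `k` on,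
with prescribed correction `v` at `k`. -/
def toggleRow (X Y Z : ℕ → ℕ) (k v : ℕ) (r : ℕ) : ℕ :=
  if r < k then Y r
  else if r = k then v + max (Z (k + 1)) (X k)
  else min (Z r) (X (r - 1)) + max (Z (r + 1)) (X r) - Y r

/-- Partial sums of a sequence. -/
def psm (X : ℕ → ℕ) (k : ℕ) : ℕ := ∑ j ∈ Finset.range k, X j

lemma psm_succ (X : ℕ → ℕ) (k : ℕ) : psm X (k + 1) = psm X k + X k := Finset.sum_range_succ _ _

lemma psm_congr {X Y : ℕ → ℕ} {k : ℕ} (h : ∀ r < k, X r = Y r) : psm X k = psm Y k :=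
  Finset.sum_congr rfl fun r hr => h r (Finset.mem_range.mp hr)

section Toggle

variable {X Y Z : ℕ → ℕ} {a b k v : ℕ}

lemma toggleRow_of_lt {r : ℕ} (h : r < k) : toggleRow X Y Z k v r = Y r := by
  simp [toggleRow, h]

lemma toggleRow_self : toggleRow X Y Z k v k = v + max (Z (k + 1)) (X k) := by
  simp [toggleRow]

lemma toggleRow_of_gt (r : ℕ) (h : k < r + 1) : toggleRow X Y Z k v (r + 1) =
    min (Z (r + 1)) (X r) + max (Z (r + 1 + 1)) (X (r + 1)) - Y (r + 1) := by
  simp [toggleRow, show ¬ r + 1 < k by omega, show ¬ r + 1 = k by omega]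

variable (hXY : ∀ r, X r ≤ Y r) (hYX : ∀ r, Y (r + 1) ≤ X r)
  (hYZ : ∀ r, Y r ≤ Z r) (hZY : ∀ r, Z (r + 1) ≤ Y r) (hba : b ≤ a)
  (hk : a + psm Y k + psm Y (k + 1) + 1 + v = b + psm Z (k + 1) + psm X k)
  (hlt : ∀ j < k, b + psm Z (j + 1) + psm X j ≤ a + psm Y j + psm Y (j + 1))

include hXY hYX hYZ hZY hba hk hlt in
lemma toggleRow_interlace (r : ℕ) :
    (X r ≤ toggleRow X Y Z k v r ∧ toggleRow X Y Z k v (r + 1) ≤ X r) ∧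
    (toggleRow X Y Z k v r ≤ Z r ∧ Z (r + 1) ≤ toggleRow X Y Z k v r) := by
  have hvX : ∀ j, k = j + 1 → v + Y k + 1 ≤ X j := by
    rintro j rfl
    have h1 := hlt j (by omega)
    simp only [psm_succ] at hk h1
    have := hZY j
    omega
  have hvZ : v + Y k + 1 ≤ Z k := by
    rcases k with _ | j
    · simp only [psm_succ] at hk
      simp [psm] at hk
      omega
    · have h1 := hlt j (by omega)
      have := hXY j
      simp only [psm_succ] at hk h1
      omega
  have low : ∀ r, X r ≤ toggleRow X Y Z k v r ∧ toggleRow X Y Z k v r ≤ Z r ∧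
      Z (r + 1) ≤ toggleRow X Y Z k v r := by
    intro r
    rcases lt_trichotomy r k with h | rfl | h
    · rw [toggleRow_of_lt h]
      exact ⟨hXY r, hYZ r, hZY r⟩
    · rw [toggleRow_self]
      have := hXY r; have := hZY r
      omega
    · obtain ⟨r, rfl⟩ : ∃ s, r = s + 1 := ⟨r - 1, by omega⟩
      rw [toggleRow_of_gt r h]
      have := hXY (r + 1); have := hYX r; have := hYZ (r + 1); have := hZY (r + 1)
      omega
  refine ⟨⟨(low r).1, ?_⟩, (low r).2⟩
  rcases lt_trichotomy (r + 1) k with h | h | h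
  · rw [toggleRow_of_lt h]
    exact hYX r
  · have := hvX r h.symm
    subst h
    rw [toggleRow_self]
    have := hXY (r + 1); have := hZY (r + 1)
    omega
  · rw [toggleRow_of_gt r h]
    have := hXY (r + 1); have := hYX r; have := hYZ (r + 1); have := hZY (r + 1)
    omega

include hXY hYX hYZ hZY hk in
lemma psm_toggleRow (j : ℕ) (hj : k ≤ j) :
    a + 1 + psm (toggleRow X Y Z k v) (j + 1) + psm Y (j + 1) =
      b + psm X j + psm Z (j + 1) + max (Z (j + 1)) (X j) := by
  induction j, hj using Nat.le_induction with
  | base =>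
    have : psm (toggleRow X Y Z k v) k = psm Y k := psm_congr fun r hr => toggleRow_of_lt hr
    rw [psm_succ (toggleRow _ _ _ _ _), toggleRow_self, this]
    omega
  | succ j hj ih =>
    rw [psm_succ (toggleRow _ _ _ _ _), psm_succ Y (j + 1), psm_succ X, psm_succ Z (j + 1),
      toggleRow_of_gt j (by omega)]
    have := hXY (j + 1); have := hYX j; have := hYZ (j + 1); have := hZY (j + 1)
    omega

include hXY hYX hYZ hZY hk in
/-- Toggling preserves the violation, and toggling twice is the identity. -/
lemma toggleRow_toggleRow :
    ∃ v', a + psm (toggleRow X Y Z k v) k + psm (toggleRow X Y Z k v) (k + 1) + 1 + v' =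
        b + psm Z (k + 1) + psm X k ∧
      toggleRow X (toggleRow X Y Z k v) Z k v' = Y := by
  have h1 : psm (toggleRow X Y Z k v) k = psm Y k := psm_congr fun r hr => toggleRow_of_lt hr
  have h2 := psm_toggleRow hXY hYX hYZ hZY hk k le_rfl
  rw [psm_succ Y] at h2
  have h3 := hXY k
  have h4 := hZY k
  refine ⟨Y k - max (Z (k + 1)) (X k), by omega, ?_⟩
  funext r
  rcases lt_trichotomy r k with h | rfl | h
  · rw [toggleRow_of_lt h, toggleRow_of_lt h]
  · rw [toggleRow_self]
    omega
  · obtain ⟨r, rfl⟩ : ∃ s, r = s + 1 := ⟨r - 1, by omega⟩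
    rw [toggleRow_of_gt r h, toggleRow_of_gt r h]
    have := hYX r; have := hYZ (r + 1); have := hXY (r + 1); have := hZY (r + 1)
    omega

end Toggle

/-- The pattern `t` violates, at letter `i` and row `k`, the condition that adding the letters of
the rows of the corresponding tableau to `α` keeps a partition. -/
def Viol (α : ℕ → ℕ) (t : ℕ → ℕ → ℕ) (i k : ℕ) : Prop :=
  α i + psm (t (i + 1)) k + psm (t (i + 1)) (k + 1) <
    α (i + 1) + psm (t (i + 1 + 1)) (k + 1) + psm (t i) k

/-- `(i, k)` is the violation with `k` minimal and then `i` maximal. -/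
def FirstViol (α : ℕ → ℕ) (t : ℕ → ℕ → ℕ) (i k : ℕ) : Prop :=
  Viol α t i k ∧ (∀ k' < k, ∀ i', ¬ Viol α t i' k') ∧ ∀ i', i < i' → ¬ Viol α t i' k

/-- The toggle of a pattern at a violation. -/
def toggle (α : ℕ → ℕ) (t : ℕ → ℕ → ℕ) (i k : ℕ) : ℕ → ℕ → ℕ :=
  Function.update t (i + 1) (toggleRow (t i) (t (i + 1)) (t (i + 1 + 1)) k
    (α (i + 1) + psm (t (i + 1 + 1)) (k + 1) + psm (t i) k -
      (α i + psm (t (i + 1)) k + psm (t (i + 1)) (k + 1) + 1)))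

lemma FirstViol.unique {α : ℕ → ℕ} {t : ℕ → ℕ → ℕ} {i k i' k' : ℕ} (h : FirstViol α t i k)
    (h' : FirstViol α t i' k') : i = i' ∧ k = k' := by
  have hk : k = k' := by
    rcases lt_trichotomy k k' with hlt | heq | hlt
    · exact absurd h.1 (h'.2.1 k hlt i)
    · exact heq
    · exact absurd h'.1 (h.2.1 k' hlt i')
  subst hk
  refine ⟨?_, rfl⟩
  rcases lt_trichotomy i i' with hlt | heq | hlt
  · exact absurd h'.1 (h.2.2 i' hlt)
  · exact heq
  · exact absurd h.1 (h'.2.2 i hlt)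

section Involution

variable {n : ℕ} {m α : ℕ → ℕ} {t : ℕ → ℕ → ℕ} {i k : ℕ}

lemma Viol.lt (ht : IsGT n m t) (hα0 : ∀ i, n ≤ i → α i = 0) (h : Viol α t i k) : i + 1 < n := by
  by_contra hn
  have h1 := hα0 (i + 1) (by omega)
  have h2 := ht.2.1 (i + 1) (by omega)
  have h3 := ht.2.1 (i + 1 + 1) (by omega)
  have h4 : psm (t i) k ≤ psm (t (i + 1)) k := ht.psum_le i k
  simp only [Viol, h1, h3, ← h2] at h
  omega

lemma exists_firstViol (ht : IsGT n m t) (hα0 : ∀ i, n ≤ i → α i = 0)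
    (h : ∃ i k, Viol α t i k) : ∃ p : ℕ × ℕ, FirstViol α t p.1 p.2 := by
  have h' : ∃ k i, Viol α t i k := by
    obtain ⟨i, k, h⟩ := h
    exact ⟨k, i, h⟩
  obtain ⟨i, hi⟩ := Nat.find_spec h'
  set k := Nat.find h'
  refine ⟨(Nat.findGreatest (fun i => Viol α t i k) n, k),
    Nat.findGreatest_spec (P := fun i => Viol α t i k) (by have := hi.lt ht hα0; omega) hi,
    fun k' hk' i' hv => Nat.find_min h' hk' ⟨i', hv⟩, fun i' hi' hv => ?_⟩
  exact Nat.findGreatest_is_greatest hi' (by have := hv.lt ht hα0; omega) hv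

lemma toggle_self (α : ℕ → ℕ) (t : ℕ → ℕ → ℕ) (i k : ℕ) : toggle α t i k (i + 1) =
    toggleRow (t i) (t (i + 1)) (t (i + 1 + 1)) k
    (α (i + 1) + psm (t (i + 1 + 1)) (k + 1) + psm (t i) k -
      (α i + psm (t (i + 1)) k + psm (t (i + 1)) (k + 1) + 1)) := by
  simp [toggle]

lemma toggle_of_ne (α : ℕ → ℕ) (t : ℕ → ℕ → ℕ) {i j : ℕ} (k : ℕ) (h : j ≠ i + 1) :
    toggle α t i k j = t j := by
  simp [toggle, h]

lemma psm_toggle_of_le (α : ℕ → ℕ) (t : ℕ → ℕ → ℕ) (i : ℕ) {k r : ℕ} (j : ℕ) (h : r ≤ k) :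
    psm (toggle α t i k j) r = psm (t j) r := by
  by_cases hj : j = i + 1
  · subst hj
    rw [toggle_self]
    exact psm_congr fun r' hr' => toggleRow_of_lt (hr'.trans_le h)
  · rw [toggle_of_ne _ _ _ hj]

lemma IsGT.toggle (ht : IsGT n m t) (hα : Antitone α) (hα0 : ∀ i, n ≤ i → α i = 0)
    (h : FirstViol α t i k) : IsGT n m (toggle α t i k) := by
  have hin := h.1.lt ht hα0
  have hv := h.1
  unfold Viol at hv
  have key := toggleRow_interlace (fun r => (ht.2.2 i r).1) (fun r => (ht.2.2 i r).2)
    (fun r => (ht.2.2 (i + 1) r).1) (fun r => (ht.2.2 (i + 1) r).2) (show α (i + 1) ≤ α i from hα (Nat.le_succ i))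
    (k := k) (v := α (i + 1) + psm (t (i + 1 + 1)) (k + 1) + psm (t i) k -
      (α i + psm (t (i + 1)) k + psm (t (i + 1)) (k + 1) + 1)) (by omega)
    (fun j hj => not_lt.mp (h.2.1 j hj i))
  rw [← toggle_self] at key
  refine ⟨by rw [toggle_of_ne _ _ _ (by omega), ht.1], fun j hj => ?_, fun j r => ?_⟩
  · rw [toggle_of_ne _ _ _ (by omega), ht.2.1 j hj]
  · by_cases h1 : j = i
    · subst h1
      rw [toggle_of_ne _ _ (i := j) (j := j) _ (by omega)]
      exact (key r).1
    · by_cases h2 : j = i + 1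
      · subst h2
        rw [toggle_of_ne _ _ (i := i) (j := i + 1 + 1) _ (by omega)]
        exact (key r).2
      · rw [toggle_of_ne _ _ _ h2, toggle_of_ne _ _ (j := j + 1) _ (by omega)]
        exact ht.2.2 j r

lemma toggle_toggle (ht : IsGT n m t) (h : FirstViol α t i k) :
    FirstViol α (toggle α t i k) i k ∧ toggle α (toggle α t i k) i k = t := by
  have hv := h.1
  unfold Viol at hv
  obtain ⟨v', hv', hinv⟩ := toggleRow_toggleRow (a := α i) (b := α (i + 1))
    (fun r => (ht.2.2 i r).1) (fun r => (ht.2.2 i r).2)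
    (fun r => (ht.2.2 (i + 1) r).1) (fun r => (ht.2.2 (i + 1) r).2)
    (k := k) (v := α (i + 1) + psm (t (i + 1 + 1)) (k + 1) + psm (t i) k -
      (α i + psm (t (i + 1)) k + psm (t (i + 1)) (k + 1) + 1)) (by omega)
  rw [← toggle_self] at hv' hinv
  refine ⟨⟨?_, fun k' hk' i' => ?_, fun i' hi' => ?_⟩, ?_⟩
  · unfold Viol
    rw [toggle_of_ne _ _ (j := i) _ (by omega), toggle_of_ne _ _ (j := i + 1 + 1) _ (by omega)]
    omega
  · have := h.2.1 k' hk' i'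
    unfold Viol at this ⊢
    simpa only [psm_toggle_of_le α t i _ hk'.le,
      psm_toggle_of_le α t i _ (Nat.succ_le_of_lt hk')] using this
  · have := h.2.2 i' hi'
    unfold Viol at this ⊢
    rw [psm_toggle_of_le α t i i' le_rfl, toggle_of_ne _ _ (j := i' + 1) _ (by omega),
      toggle_of_ne _ _ (j := i' + 1 + 1) _ (by omega)]
    exact this
  · funext j
    by_cases hj : j = i + 1
    · subst hj
      rw [toggle_self, toggle_of_ne _ _ (j := i) _ (by omega),
        toggle_of_ne _ _ (j := i + 1 + 1) _ (by omega)]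
      convert hinv using 2
      omega
    · rw [toggle_of_ne _ _ _ hj, toggle_of_ne _ _ _ hj]

lemma wt_toggle (ht : IsGT n m t) (hα : Antitone α) (hα0 : ∀ i, n ≤ i → α i = 0)
    (h : FirstViol α t i k) :
    α i + 1 + wt (toggle α t i k) i = α (i + 1) + wt t (i + 1) ∧
    α (i + 1) + wt (toggle α t i k) (i + 1) = α i + 1 + wt t i ∧
    ∀ j, j ≠ i → j ≠ i + 1 → wt (toggle α t i k) j = wt t j := by
  have ht' := ht.toggle hα hα0 h
  have hv := h.1
  unfold Viol at hv
  set j := max k (i + 1) with hj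
  have key := psm_toggleRow (a := α i) (b := α (i + 1))
    (fun r => (ht.2.2 i r).1) (fun r => (ht.2.2 i r).2)
    (fun r => (ht.2.2 (i + 1) r).1) (fun r => (ht.2.2 (i + 1) r).2)
    (k := k) (v := α (i + 1) + psm (t (i + 1 + 1)) (k + 1) + psm (t i) k -
      (α i + psm (t (i + 1)) k + psm (t (i + 1)) (k + 1) + 1)) (by omega) j (le_max_left _ _)
  rw [← toggle_self, ht.eq_zero (show i + 2 ≤ j + 1 by omega), max_eq_right (Nat.zero_le _)] at key
  have h0 := psm_succ (t i) j
  have e1 := ht.psum_add_wt (show i + 1 ≤ j + 1 by omega)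
  have e2 := ht.psum_add_wt (show i + 1 + 1 ≤ j + 1 by omega)
  have e3 := ht'.psum_add_wt (show i + 1 ≤ j + 1 by omega)
  have e4 := ht'.psum_add_wt (show i + 1 + 1 ≤ j + 1 by omega)
  change psm (t i) (j + 1) + _ = psm (t (i + 1)) (j + 1) at e1
  change psm (t (i + 1)) (j + 1) + _ = psm (t (i + 1 + 1)) (j + 1) at e2
  change psm (toggle α t i k i) (j + 1) + _ = psm (toggle α t i k (i + 1)) (j + 1) at e3
  change psm (toggle α t i k (i + 1)) (j + 1) + _ = psm (toggle α t i k (i + 1 + 1)) (j + 1) at e4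
  rw [toggle_of_ne _ _ (j := i) _ (by omega)] at e3
  rw [toggle_of_ne _ _ (j := i + 1 + 1) _ (by omega)] at e4
  refine ⟨by omega, by omega, fun l h1 h2 => ?_⟩
  simp only [wt, psum]
  rw [toggle_of_ne _ _ (j := l) _ h2, toggle_of_ne _ _ (j := l + 1) _ (by omega)]

/-- The involution on patterns: toggle at the first violation. -/
def flip (α : ℕ → ℕ) (t : ℕ → ℕ → ℕ) : ℕ → ℕ → ℕ :=
  if h : ∃ p : ℕ × ℕ, FirstViol α t p.1 p.2 then toggle α t h.choose.1 h.choose.2 else t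

lemma FirstViol.flip_eq (h : FirstViol α t i k) : flip α t = toggle α t i k := by
  have hex : ∃ p : ℕ × ℕ, FirstViol α t p.1 p.2 := ⟨(i, k), h⟩
  obtain ⟨h1, h2⟩ := hex.choose_spec.unique h
  rw [flip, dif_pos hex, h1, h2]

end Involution

/-- Only the patterns without violations contribute to the expansion of the determinant. -/
lemma sum_det_eq_sum_filter (B : ℕ → ℚ) (n : ℕ) (m α : ℕ → ℕ) (hα : Antitone α)
    (hα0 : ∀ i, n ≤ i → α i = 0) :
    ∑ t ∈ gtSet n m, (Matrix.of fun i j : Fin n => B (α i + (n - 1 - i) + wt t i + j)).det =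
      ∑ t ∈ (gtSet n m).filter (fun t => ∀ i k, ¬ Viol α t i k),
        (Matrix.of fun i j : Fin n => B (α i + (n - 1 - i) + wt t i + j)).det := by
  rw [← Finset.sum_filter_add_sum_filter_not (gtSet n m) (fun t => ∀ i k, ¬ Viol α t i k),
    add_eq_left]
  have hfirst : ∀ t ∈ (gtSet n m).filter (fun t => ¬ ∀ i k, ¬ Viol α t i k),
      IsGT n m t ∧ ∃ p : ℕ × ℕ, FirstViol α t p.1 p.2 := by
    intro t ht
    rw [Finset.mem_filter, mem_gtSet] at ht
    refine ⟨ht.1, exists_firstViol ht.1 hα0 ?_⟩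
    have := ht.2
    push Not at this
    exact this
  have hneg : ∀ t ∈ (gtSet n m).filter (fun t => ¬ ∀ i k, ¬ Viol α t i k),
      (Matrix.of fun i j : Fin n => B (α i + (n - 1 - i) + wt t i + j)).det +
      (Matrix.of fun i j : Fin n => B (α i + (n - 1 - i) + wt (flip α t) i + j)).det = 0 := by
    intro t ht
    obtain ⟨hgt, ⟨i, k⟩, h⟩ := hfirst t ht
    have hi := h.1.lt hgt hα0
    obtain ⟨w1, w2, w3⟩ := wt_toggle hgt hα hα0 h
    rw [h.flip_eq]
    have hne : (⟨i, by omega⟩ : Fin n) ≠ ⟨i + 1, hi⟩ := by simp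
    have : (Matrix.of fun l j : Fin n =>
        B (α l + (n - 1 - l) + wt (toggle α t i k) l + j)) =
        (Matrix.of fun l j : Fin n => B (α l + (n - 1 - l) + wt t l + j)).submatrix
          (Equiv.swap ⟨i, by omega⟩ ⟨i + 1, hi⟩) id := by
      ext l j
      simp only [Matrix.of_apply, Matrix.submatrix_apply, id_eq]
      by_cases h1 : l = ⟨i, by omega⟩
      · subst h1
        rw [Equiv.swap_apply_left]
        dsimp only
        congr 2
        dsimp only at w1
        omega
      · by_cases h2 : l = ⟨i + 1, hi⟩
        · subst h2
          rw [Equiv.swap_apply_right]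
          dsimp only
          congr 2
          dsimp only at w2
          omega
        · rw [Equiv.swap_apply_of_ne_of_ne h1 h2,
            w3 l (fun e => h1 (Fin.ext e)) (fun e => h2 (Fin.ext e))]
    rw [this, Matrix.det_permute, Equiv.Perm.sign_swap hne]
    simp
  refine Finset.sum_involution (fun t _ => flip α t) hneg ?_ ?_ ?_
  · intro t ht hne heq
    have := hneg t ht
    rw [heq] at this
    exact hne (by linarith)
  · intro t ht
    obtain ⟨hgt, ⟨i, k⟩, h⟩ := hfirst t ht
    rw [h.flip_eq, Finset.mem_filter, mem_gtSet]
    exact ⟨hgt.toggle hα hα0 h, fun hall => hall i k (toggle_toggle hgt h).1.1⟩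
  · intro t ht
    obtain ⟨hgt, ⟨i, k⟩, h⟩ := hfirst t ht
    rw [h.flip_eq, (toggle_toggle hgt h).1.flip_eq, (toggle_toggle hgt h).2]

section LittlewoodRichardson

variable {α μ ρ : YoungDiagram} {T : ℕ × ℕ → ℕ} {g : ℕ → ℕ → ℕ}

lemma mem_skew {i j : ℕ} :
    (i, j) ∈ ρ.cells \ α.cells ↔ j < ρ.rowLen i ∧ α.rowLen i ≤ j := by
  rw [Finset.mem_sdiff, YoungDiagram.mem_cells, YoungDiagram.mem_cells,
    YoungDiagram.mem_iff_lt_rowLen, YoungDiagram.mem_iff_lt_rowLen, not_lt]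

/-- `g i k` is the number of boxes in row `i` of `ρ` whose entry is at most `k`. -/
def Encodes (ρ : YoungDiagram) (T : ℕ × ℕ → ℕ) (g : ℕ → ℕ → ℕ) : Prop :=
  ∀ i j k, j < g i k ↔ j < ρ.rowLen i ∧ T (i, j) ≤ k

lemma exists_encodes (hsupp : ∀ c : ℕ × ℕ, c ∈ ρ.cells \ α.cells ↔ T c ≠ 0)
    (hrow : ∀ i j j', j ≤ j' → (i, j) ∈ ρ.cells \ α.cells → (i, j') ∈ ρ.cells \ α.cells →
      T (i, j) ≤ T (i, j')) : ∃ g, Encodes ρ T g := by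
  have h : ∀ i k, ∃ m, ∀ j, j < m ↔ j < ρ.rowLen i ∧ T (i, j) ≤ k := by
    intro i k
    have hex : ∃ m, ¬ (m < ρ.rowLen i ∧ T (i, m) ≤ k) := ⟨ρ.rowLen i, by simp⟩
    refine ⟨Nat.find hex, fun j => ⟨fun hj => not_not.mp (Nat.find_min hex hj), fun hj => ?_⟩⟩
    rw [Nat.lt_find_iff]
    refine fun m hm => not_not.mpr ⟨by omega, ?_⟩
    by_cases h0 : T (i, m) = 0
    · omega
    · have hm' := (hsupp (i, m)).mpr h0
      rw [mem_skew] at hm'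
      exact (hrow i m j hm (mem_skew.mpr hm') (mem_skew.mpr ⟨hj.1, by omega⟩)).trans hj.2
  choose g hg using h
  exact ⟨g, fun i j k => hg i k j⟩

lemma Encodes.mono (h : Encodes ρ T g) (i : ℕ) : Monotone (g i) := by
  intro k k' hk
  by_contra hlt
  rw [not_le] at hlt
  have h1 := (h i _ k).mp hlt
  exact absurd ((h i (g i k') k').mpr ⟨h1.1, h1.2.trans hk⟩) (lt_irrefl _)

lemma Encodes.le_rowLen (h : Encodes ρ T g) (i k : ℕ) : g i k ≤ ρ.rowLen i := by
  by_contra hlt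
  rw [not_le] at hlt
  exact absurd ((h i _ k).mp hlt).1 (lt_irrefl _)

lemma Encodes.zero (h : Encodes ρ T g) (hle : α ≤ ρ)
    (hsupp : ∀ c : ℕ × ℕ, c ∈ ρ.cells \ α.cells ↔ T c ≠ 0) (i : ℕ) : g i 0 = α.rowLen i := by
  refine eq_of_forall_lt_iff fun j => ?_
  rw [h i j 0, nonpos_iff_eq_zero]
  have h1 := hsupp (i, j)
  rw [mem_skew] at h1
  have h2 : j < α.rowLen i → j < ρ.rowLen i := by
    rw [← YoungDiagram.mem_iff_lt_rowLen, ← YoungDiagram.mem_iff_lt_rowLen]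
    exact fun hj => hle hj
  by_cases hT : T (i, j) = 0
  · simp only [hT, ne_eq, not_true_eq_false, iff_false] at h1
    simp only [hT]
    grind
  · simp only [hT, ne_eq, not_false_eq_true, iff_true] at h1
    simp only [hT]
    grind

lemma Encodes.apply_eq_iff (h : Encodes ρ T g)
    (hsupp : ∀ c : ℕ × ℕ, c ∈ ρ.cells \ α.cells ↔ T c ≠ 0) (i j k : ℕ) :
    ((i, j) ∈ ρ.cells \ α.cells ∧ T (i, j) = k + 1) ↔ g i k ≤ j ∧ j < g i (k + 1) := by
  rw [← not_lt, h i j k, h i j (k + 1)]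
  constructor
  · rintro ⟨h1, h2⟩
    rw [mem_skew] at h1
    omega
  · rintro ⟨h1, h2⟩
    have h3 : T (i, j) = k + 1 := by
      have : ¬ T (i, j) ≤ k := fun h => h1 ⟨h2.1, h⟩
      omega
    exact ⟨(hsupp _).mpr (by omega), h3⟩

/-- The number of boxes with entry `k + 1` in the rows above row `i`. -/
def count (g : ℕ → ℕ → ℕ) (i k : ℕ) : ℕ := ∑ i' ∈ Finset.range i, (g i' (k + 1) - g i' k)

lemma count_succ (g : ℕ → ℕ → ℕ) (i k : ℕ) :
    count g (i + 1) k = count g i k + (g i (k + 1) - g i k) := Finset.sum_range_succ _ _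

lemma Encodes.card_filter (h : Encodes ρ T g)
    (hsupp : ∀ c : ℕ × ℕ, c ∈ ρ.cells \ α.cells ↔ T c ≠ 0) (i j k : ℕ) :
    ((ρ.cells \ α.cells).filter
      (fun d => (d.1 < i ∨ (d.1 = i ∧ j ≤ d.2)) ∧ T d = k + 1)).card =
      count g i k + (g i (k + 1) - max j (g i k)) := by
  have : ((ρ.cells \ α.cells).filter
      (fun d => (d.1 < i ∨ (d.1 = i ∧ j ≤ d.2)) ∧ T d = k + 1)).card =
      ((Finset.range (i + 1)).sigma fun i' =>
        Finset.Ico (if i' = i then max j (g i k) else g i' k) (g i' (k + 1))).card := by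
    refine Finset.card_nbij' (fun d => ⟨d.1, d.2⟩) (fun s => (s.1, s.2)) ?_ ?_ ?_ ?_
    · rintro ⟨a, b⟩ hd
      simp only [Finset.coe_filter, Set.mem_ofPred_eq] at hd
      have h1 := (h.apply_eq_iff hsupp a b k).mp ⟨hd.1, hd.2.2⟩
      simp only [Finset.coe_sigma, Set.mem_sigma_iff, Finset.coe_range, Set.mem_Iio,
        Finset.coe_Ico, Set.mem_Ico]
      refine ⟨by omega, ?_, h1.2⟩
      split_ifs with ha
      · subst ha
        have := h1.1
        exact max_le (by omega) this
      · exact h1.1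
    · rintro ⟨a, b⟩ hd
      simp only [Finset.coe_sigma, Set.mem_sigma_iff, Finset.coe_range, Set.mem_Iio,
        Finset.coe_Ico, Set.mem_Ico] at hd
      have h2 : g a k ≤ b ∧ (a = i → j ≤ b) := by
        have := hd.2.1
        split_ifs at this with ha
        · subst ha
          exact ⟨(le_max_right _ _).trans this, fun _ => (le_max_left _ _).trans this⟩
        · exact ⟨this, fun h => absurd h ha⟩
      have h1 := (h.apply_eq_iff hsupp a b k).mpr ⟨h2.1, hd.2.2⟩
      simp only [Finset.coe_filter, Set.mem_ofPred_eq]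
      refine ⟨h1.1, ?_, h1.2⟩
      by_cases ha : a = i
      · exact Or.inr ⟨ha, h2.2 ha⟩
      · exact Or.inl (by omega)
    · intro d _
      rfl
    · intro s _
      rfl
  rw [this, Finset.card_sigma, Finset.sum_range_succ, count]
  simp only [Nat.card_Ico, if_true]
  congr 1
  refine Finset.sum_congr rfl fun i' hi' => ?_
  rw [if_neg (Finset.mem_range.mp hi').ne]

lemma Encodes.card_filter_eq (h : Encodes ρ T g)
    (hsupp : ∀ c : ℕ × ℕ, c ∈ ρ.cells \ α.cells ↔ T c ≠ 0) {n : ℕ}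
    (hn : ∀ i, n ≤ i → ρ.rowLen i = 0) (k : ℕ) :
    ((ρ.cells \ α.cells).filter (fun d => T d = k + 1)).card = count g n k := by
  have h1 := h.card_filter hsupp n 0 k
  have h2 := h.le_rowLen n (k + 1)
  rw [hn n le_rfl] at h2
  rw [show g n (k + 1) - max 0 (g n k) = 0 by omega, add_zero] at h1
  rw [← h1]
  congr 1
  refine Finset.filter_congr fun d hd => ?_
  have := (mem_skew (i := d.1) (j := d.2)).mp hd
  have h3 : d.1 < n := by
    by_contra hc
    have := hn d.1 (by omega)
    omega
  simp [h3]

lemma Encodes.lattice_iff (h : Encodes ρ T g)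
    (hsupp : ∀ c : ℕ × ℕ, c ∈ ρ.cells \ α.cells ↔ T c ≠ 0) :
    (∀ c ∈ ρ.cells \ α.cells, ∀ k : ℕ,
    (((ρ.cells \ α.cells).filter
        (fun d => (d.1 < c.1 ∨ (d.1 = c.1 ∧ c.2 ≤ d.2)) ∧ T d = k + 2)).card ≤
     ((ρ.cells \ α.cells).filter
        (fun d => (d.1 < c.1 ∨ (d.1 = c.1 ∧ c.2 ≤ d.2)) ∧ T d = k + 1)).card)) ↔
    ∀ i k, count g (i + 1) (k + 1) ≤ count g i k := by
  constructor
  · intro hl i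
    induction i with
    | zero =>
      intro k
      by_cases hlt : g 0 (k + 1) < g 0 (k + 1 + 1)
      · have hm := ((h.apply_eq_iff hsupp 0 (g 0 (k + 1)) (k + 1)).mpr ⟨le_rfl, hlt⟩).1
        have := hl _ hm k
        rw [h.card_filter hsupp 0 _ (k + 1), h.card_filter hsupp 0 _ k] at this
        rw [count_succ]
        simp only [max_self] at this
        have h2 := h.mono 0 (Nat.le_succ k)
        rw [Nat.succ_eq_add_one] at h2
        rw [max_eq_left h2] at this
        omega
      · rw [count_succ]
        simp only [count, Finset.range_zero, Finset.sum_empty]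
        omega
    | succ i ih =>
      intro k
      by_cases hlt : g (i + 1) (k + 1) < g (i + 1) (k + 1 + 1)
      · have hm := ((h.apply_eq_iff hsupp (i + 1) (g (i + 1) (k + 1)) (k + 1)).mpr ⟨le_rfl, hlt⟩).1
        have := hl _ hm k
        rw [h.card_filter hsupp (i + 1) _ (k + 1), h.card_filter hsupp (i + 1) _ k] at this
        rw [count_succ]
        simp only [max_self] at this
        have h2 := h.mono (i + 1) (Nat.le_succ k)
        rw [Nat.succ_eq_add_one] at h2
        rw [max_eq_left h2] at this
        omega
      · rw [count_succ]
        have h1 := ih k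
        have h2 := count_succ g i k
        omega
  · rintro hc ⟨i, j⟩ _ k
    rw [h.card_filter hsupp i _ (k + 1), h.card_filter hsupp i _ k]
    have h1 := hc i k
    have h2 := count_succ g i (k + 1)
    have h3 : g i (k + 1) ≤ max j (g i (k + 1)) := le_max_right _ _
    omega

lemma Encodes.column_iff (h : Encodes ρ T g)
    (hsupp : ∀ c : ℕ × ℕ, c ∈ ρ.cells \ α.cells ↔ T c ≠ 0) :
    (∀ i i' j, i < i' → (i, j) ∈ ρ.cells \ α.cells → (i', j) ∈ ρ.cells \ α.cells →
      T (i, j) < T (i', j)) ↔ ∀ i k, g (i + 1) (k + 1) ≤ g i k := by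
  constructor
  · intro hcol i k
    by_contra hlt
    rw [not_le] at hlt
    have h1 := (h _ _ _).mp hlt
    have h2 := ρ.rowLen_anti i (i + 1) (Nat.le_succ i)
    have h3 : ¬ (g i k < ρ.rowLen i ∧ T (i, g i k) ≤ k) := by
      rw [← h i (g i k) k]
      exact lt_irrefl _
    have h4 : ¬ T (i, g i k) ≤ k := fun h => h3 ⟨by omega, h⟩
    have h5 : (i, g i k) ∈ ρ.cells \ α.cells := (hsupp _).mpr (by omega)
    have h7 := α.rowLen_anti i (i + 1) (Nat.le_succ i)
    have h6 : (i + 1, g i k) ∈ ρ.cells \ α.cells := by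
      rw [mem_skew] at h5 ⊢
      omega
    have := hcol i (i + 1) _ (Nat.lt_succ_self i) h5 h6
    omega
  · intro hg
    have step : ∀ i j, (i + 1, j) ∈ ρ.cells \ α.cells → T (i, j) < T (i + 1, j) := by
      intro i j hj
      obtain ⟨k, hk⟩ := Nat.exists_eq_succ_of_ne_zero ((hsupp _).mp hj)
      have h1 := ((h.apply_eq_iff hsupp (i + 1) j k).mp ⟨hj, hk⟩).2
      have h2 := ((h i j k).mp (h1.trans_le (hg i k))).2
      omega
    intro i i' j hi
    induction i', hi using Nat.le_induction with
    | base => exact fun _ h' => step i j h'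
    | succ i' hi ih =>
      intro h1 h2
      refine (ih h1 ?_).trans (step i' j h2)
      have h3 := ρ.rowLen_anti i' (i' + 1) (Nat.le_succ i')
      have h4 := α.rowLen_anti i i' (by omega)
      rw [mem_skew] at h1 h2 ⊢
      omega

end LittlewoodRichardson

section LittlewoodRichardson

variable {α μ ρ : YoungDiagram} {T : ℕ × ℕ → ℕ} {g : ℕ → ℕ → ℕ}

/-- The encoding of a filling by its row counts. -/
def rowCount (ρ : YoungDiagram) (T : ℕ × ℕ → ℕ) (i k : ℕ) : ℕ :=
  ((Finset.range (ρ.rowLen i)).filter (fun j => T (i, j) ≤ k)).card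

lemma Encodes.eq_rowCount (h : Encodes ρ T g) : g = rowCount ρ T := by
  funext i k
  rw [rowCount, ← Finset.card_range (g i k)]
  congr 1
  ext j
  rw [Finset.mem_range, Finset.mem_filter, Finset.mem_range, h i j k]

/-- The row counts recovered from a pattern. -/
def ofPattern (α : ℕ → ℕ) (t : ℕ → ℕ → ℕ) (i k : ℕ) : ℕ :=
  α i + psm (t (i + 1)) k - psm (t i) k

lemma psm_count_succ {α : ℕ → ℕ} (hg : ∀ i, Monotone (g i)) (h0 : ∀ i, g i 0 = α i) (i k : ℕ) :
    psm (count g (i + 1)) k = psm (count g i) k + (g i k - α i) := by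
  induction k with
  | zero => simp [psm, h0]
  | succ k ih =>
    have h1 := hg i (Nat.le_succ k)
    have h2 := hg i (Nat.zero_le k)
    rw [h0, Nat.succ_eq_add_one] at *
    rw [psm_succ, psm_succ, ih, count_succ]
    omega

lemma ofPattern_count {α : ℕ → ℕ} (hg : ∀ i, Monotone (g i)) (h0 : ∀ i, g i 0 = α i) :
    ofPattern α (count g) = g := by
  funext i k
  have h2 := hg i (Nat.zero_le k)
  rw [h0] at h2
  rw [ofPattern, psm_count_succ hg h0]
  omega

section Pattern

variable {n : ℕ} {m a : ℕ → ℕ} {t : ℕ → ℕ → ℕ}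

lemma IsGT.psm_le (ht : IsGT n m t) (i k : ℕ) : psm (t i) k ≤ psm (t (i + 1)) k := ht.psum_le i k

lemma IsGT.count_ofPattern (ht : IsGT n m t) (a : ℕ → ℕ) : count (ofPattern a t) = t := by
  funext i k
  induction i with
  | zero => simp [count, ht.1]
  | succ i ih =>
    rw [count_succ, ih, ofPattern, ofPattern, psm_succ, psm_succ]
    have h1 := ht.psm_le i k
    have h2 := (ht.2.2 i k).1
    omega

lemma IsGT.ofPattern_zero (a : ℕ → ℕ) (t : ℕ → ℕ → ℕ) (i : ℕ) : ofPattern a t i 0 = a i := by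
  simp [ofPattern, psm]

lemma IsGT.ofPattern_mono (ht : IsGT n m t) (a : ℕ → ℕ) (i : ℕ) : Monotone (ofPattern a t i) := by
  refine monotone_nat_of_le_succ fun k => ?_
  rw [ofPattern, ofPattern, psm_succ, psm_succ]
  have h1 := ht.psm_le i k
  have h2 := (ht.2.2 i k).1
  omega

lemma IsGT.ofPattern_eq (ht : IsGT n m t) (a : ℕ → ℕ) {i k : ℕ} (hk : i + 1 ≤ k) :
    ofPattern a t i k = a i + wt t i := by
  have h : psm (t i) k + wt t i = psm (t (i + 1)) k := ht.psum_add_wt hk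
  rw [ofPattern]
  omega

lemma IsGT.viol_iff (ht : IsGT n m t) (i k : ℕ) :
    Viol a t i k ↔ ofPattern a t i k < ofPattern a t (i + 1) (k + 1) := by
  have h1 := ht.psm_le i k
  have h2 := ht.psm_le (i + 1) (k + 1)
  rw [Viol, ofPattern, ofPattern]
  omega

lemma IsGT.le_ofPattern (ht : IsGT n m t) (hv : ∀ i k, ¬ Viol a t i k) {i k : ℕ} (hk : k ≤ i) :
    t (i + 1) k + ofPattern a t i k ≤ ofPattern a t k (k + 1) := by
  have step : ∀ j, t (j + 1) k + ofPattern a t j k = t j k + ofPattern a t j (k + 1) := by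
    intro j
    have h1 := ht.psm_le j k
    have h2 := (ht.2.2 j k).1
    rw [ofPattern, ofPattern, psm_succ, psm_succ]
    omega
  induction i, hk using Nat.le_induction with
  | base => rw [step, ht.eq_zero le_rfl, zero_add]
  | succ i hi ih =>
    rw [step]
    have := (ht.viol_iff (a := a) i k).not.mp (hv i k)
    omega

end Pattern

/-- The patterns which correspond to Littlewood–Richardson tableaux. -/
def lrSet (n : ℕ) (α μ ρ : YoungDiagram) : Finset (ℕ → ℕ → ℕ) :=
  (gtSet n μ.rowLen).filter (fun t => (∀ i k, ¬ Viol α.rowLen t i k) ∧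
    ∀ i, ρ.rowLen i = α.rowLen i + wt t i)

lemma mem_lrSet {n : ℕ} {t : ℕ → ℕ → ℕ} : t ∈ lrSet n α μ ρ ↔ IsGT n μ.rowLen t ∧
    (∀ i k, ¬ Viol α.rowLen t i k) ∧ ∀ i, ρ.rowLen i = α.rowLen i + wt t i := by
  rw [lrSet, Finset.mem_filter, mem_gtSet]

lemma count_mem_lrSet {n : ℕ} (hn : ∀ i, n ≤ i → ρ.rowLen i = 0) (hle : α ≤ ρ)
    (h : Encodes ρ T g) (hT : IsLRTableau α μ ρ T) : count g ∈ lrSet n α μ ρ := by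
  obtain ⟨hsupp, _, hcol, hcon, hlat⟩ := hT
  rw [h.column_iff hsupp] at hcol
  rw [h.lattice_iff hsupp] at hlat
  have hg0 := h.zero hle hsupp
  have hg := ofPattern_count h.mono hg0
  have ht : IsGT n μ.rowLen (count g) := by
    refine ⟨by funext k; simp [count], fun i hi => ?_, fun i k => ⟨?_, hlat i k⟩⟩
    · funext k
      rw [← hcon k, h.card_filter_eq hsupp (fun j hj => hn j (hi.trans hj))]
    · rw [count_succ]
      omega
  refine mem_lrSet.mpr ⟨ht, fun i k => ?_, fun i => ?_⟩
  · rw [ht.viol_iff, hg, not_lt]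
    exact hcol i k
  · rw [← ht.ofPattern_eq α.rowLen le_rfl, hg]
    refine le_antisymm ?_ (h.le_rowLen _ _)
    by_contra hlt
    rw [not_le] at hlt
    have h2 := (h i (g i (i + 1)) (T (i, g i (i + 1)))).mpr ⟨hlt, le_rfl⟩
    have h3 : g i (T (i, g i (i + 1))) ≤ g i (max (i + 1) (T (i, g i (i + 1)))) :=
      h.mono i (le_max_right _ _)
    have h4 := ht.ofPattern_eq α.rowLen (le_max_left (i + 1) (T (i, g i (i + 1))))
    have h5 := ht.ofPattern_eq α.rowLen (le_refl (i + 1))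
    rw [hg] at h4 h5
    omega

lemma exists_tableau {n : ℕ} (hn : ∀ i, n ≤ i → ρ.rowLen i = 0) {t : ℕ → ℕ → ℕ}
    (ht : t ∈ lrSet n α μ ρ) : ∃ T, IsLRTableau α μ ρ T ∧ Encodes ρ T (ofPattern α.rowLen t) := by
  obtain ⟨ht, hv, hw⟩ := mem_lrSet.mp ht
  set g := ofPattern α.rowLen t with hg
  have hmono : ∀ i, Monotone (g i) := ht.ofPattern_mono _
  have hg0 : ∀ i, g i 0 = α.rowLen i := IsGT.ofPattern_zero _ _
  have hgρ : ∀ i k, i + 1 ≤ k → g i k = ρ.rowLen i := fun i k hk => by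
    rw [hg, ht.ofPattern_eq _ hk, hw]
  have hex : ∀ c : ℕ × ℕ, c.2 < ρ.rowLen c.1 → ∃ k, c.2 < g c.1 k :=
    fun c hc => ⟨c.1 + 1, by rwa [hgρ _ _ le_rfl]⟩
  let T : ℕ × ℕ → ℕ := fun c => if hc : c.2 < ρ.rowLen c.1 then Nat.find (hex c hc) else 0
  have henc : Encodes ρ T g := by
    intro i j k
    constructor
    · intro hj
      have h1 : j < ρ.rowLen i := by
        rw [← hgρ i (max k (i + 1)) (le_max_right _ _)]
        exact hj.trans_le (hmono i (le_max_left _ _))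
      refine ⟨h1, ?_⟩
      simp only [T, h1, dif_pos]
      exact Nat.find_min' _ hj
    · rintro ⟨h1, h2⟩
      simp only [T, h1, dif_pos] at h2
      exact (Nat.find_spec (hex (i, j) h1)).trans_le (hmono i h2)
  have hsupp : ∀ c : ℕ × ℕ, c ∈ ρ.cells \ α.cells ↔ T c ≠ 0 := by
    rintro ⟨i, j⟩
    have h1 := henc i j 0
    rw [hg0] at h1
    have h2 : ¬ j < ρ.rowLen i → T (i, j) = 0 := fun h => dif_neg h
    rw [mem_skew]
    grind
  refine ⟨T, ⟨hsupp, ?_, ?_, ?_, ?_⟩, henc⟩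
  · intro i j j' hj h1 h2
    rw [mem_skew] at h1 h2
    have h3 := (henc i j' (T (i, j'))).mpr ⟨h2.1, le_rfl⟩
    exact ((henc i j _).mp (hj.trans_lt h3)).2
  · rw [henc.column_iff hsupp]
    exact fun i k => not_lt.mp ((ht.viol_iff i k).not.mp (hv i k))
  · intro k
    rw [henc.card_filter_eq hsupp hn, hg, ht.count_ofPattern, ht.2.1 n le_rfl]
  · rw [henc.lattice_iff hsupp, hg, ht.count_ofPattern]
    exact fun i k => (ht.2.2 i k).2

lemma le_iff_rowLen_le : α ≤ ρ ↔ ∀ i, α.rowLen i ≤ ρ.rowLen i := by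
  constructor
  · intro h i
    by_contra hlt
    rw [not_le] at hlt
    have := h (YoungDiagram.mem_iff_lt_rowLen.mpr hlt)
    exact absurd (YoungDiagram.mem_iff_lt_rowLen.mp this) (lt_irrefl _)
  · rintro h ⟨i, j⟩ hc
    exact YoungDiagram.mem_iff_lt_rowLen.mpr
      ((YoungDiagram.mem_iff_lt_rowLen.mp hc).trans_le (h i))

lemma lrCoeff_eq_card {n : ℕ} (hn : ∀ i, n ≤ i → ρ.rowLen i = 0) :
    lrCoeff α μ ρ = (lrSet n α μ ρ).card := by
  by_cases hle : α ≤ ρ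
  · rw [lrCoeff, if_pos hle, ← Fintype.card_coe, ← Nat.card_eq_fintype_card]
    have henc : ∀ T, IsLRTableau α μ ρ T → Encodes ρ T (rowCount ρ T) := by
      intro T hT
      obtain ⟨g, hg⟩ := exists_encodes hT.1 hT.2.1
      rwa [← hg.eq_rowCount]
    refine Nat.card_eq_of_bijective (fun T => ⟨count (rowCount ρ T.1),
      count_mem_lrSet hn hle (henc T.1 T.2) T.2⟩) ⟨?_, ?_⟩
    · rintro ⟨T, hT⟩ ⟨T', hT'⟩ heq
      have h1 := henc T hT
      have h2 := henc T' hT'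
      have h3 : rowCount ρ T = rowCount ρ T' := by
        rw [← ofPattern_count h1.mono (h1.zero hle hT.1),
          ← ofPattern_count h2.mono (h2.zero hle hT'.1), Subtype.mk.inj heq]
      rw [← h3] at h2
      refine Subtype.ext (funext fun ⟨i, j⟩ => ?_)
      change T (i, j) = T' (i, j)
      by_cases hj : j < ρ.rowLen i
      · refine eq_of_forall_ge_iff fun k => ?_
        have h4 := h1 i j k
        rw [h2 i j k] at h4
        simpa [hj] using h4.symm
      · have h4 : (i, j) ∉ ρ.cells \ α.cells := fun h => hj (mem_skew.mp h).1
        rw [not_not.mp ((hT.1 _).not.mp h4), not_not.mp ((hT'.1 _).not.mp h4)]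
    · rintro ⟨t, ht⟩
      obtain ⟨T, hT, hg⟩ := exists_tableau hn ht
      refine ⟨⟨T, hT⟩, Subtype.ext ?_⟩
      simp only
      rw [← hg.eq_rowCount]
      exact (mem_lrSet.mp ht).1.count_ofPattern _
  · rw [lrCoeff, if_neg hle, eq_comm, Finset.card_eq_zero, Finset.eq_empty_iff_forall_notMem]
    intro t ht
    refine hle (le_iff_rowLen_le.mpr fun i => ?_)
    rw [(mem_lrSet.mp ht).2.2 i]
    omega

end LittlewoodRichardson

lemma rowLen_eq_zero {ρ : YoungDiagram} {i : ℕ} (h : ρ.card ≤ i) : ρ.rowLen i = 0 := by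
  by_contra h0
  have hsub : (Finset.range (i + 1)).map ⟨fun a => (a, 0), fun a b h => (Prod.mk.inj h).1⟩ ⊆
      ρ.cells := by
    intro c hc
    simp only [Finset.mem_map, Finset.mem_range] at hc
    obtain ⟨a, ha, rfl⟩ := hc
    change (a, 0) ∈ ρ.cells
    rw [YoungDiagram.mem_cells, YoungDiagram.mem_iff_lt_rowLen]
    have := ρ.rowLen_anti a i (by omega)
    omega
  have := Finset.card_le_card hsub
  rw [Finset.card_map, Finset.card_range] at this
  change i + 1 ≤ ρ.card at this
  omega

@[to_additive]
lemma prod_cells {M : Type*} [CommMonoid M] (ρ : YoungDiagram) {n : ℕ}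
    (hn : ∀ i, n ≤ i → ρ.rowLen i = 0) (F : ℕ × ℕ → M) :
    ∏ c ∈ ρ.cells, F c = ∏ i ∈ Finset.range n, ∏ j ∈ Finset.range (ρ.rowLen i), F (i, j) := by
  rw [Finset.prod_sigma']
  refine Finset.prod_nbij' (fun c => ⟨c.1, c.2⟩) (fun s => (s.1, s.2)) ?_ ?_ ?_ ?_ ?_
  · rintro ⟨i, j⟩ hc
    rw [YoungDiagram.mem_cells, YoungDiagram.mem_iff_lt_rowLen] at hc
    simp only [Finset.mem_sigma, Finset.mem_range]
    refine ⟨?_, hc⟩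
    by_contra hi
    have := hn i (by omega)
    omega
  · rintro ⟨i, j⟩ hc
    simp only [Finset.mem_sigma, Finset.mem_range] at hc
    rw [YoungDiagram.mem_cells, YoungDiagram.mem_iff_lt_rowLen]
    exact hc.2
  · intro c _
    rfl
  · intro c _
    rfl
  · intro c _
    rfl

lemma card_eq_sum (ρ : YoungDiagram) {n : ℕ} (hn : ∀ i, n ≤ i → ρ.rowLen i = 0) :
    ρ.card = ∑ i ∈ Finset.range n, ρ.rowLen i := by
  have := sum_cells ρ hn (fun _ => 1)
  simpa using this

/-- The Young diagram with given row lengths. -/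
def rowsDiagram (n : ℕ) (r : ℕ → ℕ) : YoungDiagram :=
  ⟨(Finset.range n ×ˢ Finset.range (r 0)).filter (fun c => ∀ i ≤ c.1, c.2 < r i), by
    rintro ⟨a, b⟩ ⟨a', b'⟩ ⟨h1, h2⟩ hp
    simp only [Finset.coe_filter, Finset.mem_product, Finset.mem_range, Set.mem_ofPred_eq] at *
    exact ⟨⟨by omega, by omega⟩, fun i hi => h2.trans_lt (hp.2 i (hi.trans h1))⟩⟩

lemma rowLen_rowsDiagram {n : ℕ} {r : ℕ → ℕ} (hr : Antitone r) (hn : ∀ i, n ≤ i → r i = 0)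
    (i : ℕ) : (rowsDiagram n r).rowLen i = r i := by
  refine eq_of_forall_lt_iff fun j => ?_
  rw [← YoungDiagram.mem_iff_lt_rowLen, ← YoungDiagram.mem_cells]
  simp only [rowsDiagram, Finset.mem_filter, Finset.mem_product, Finset.mem_range]
  constructor
  · exact fun h => h.2 i le_rfl
  · intro h
    refine ⟨⟨?_, h.trans_le (hr (Nat.zero_le i))⟩, fun i' hi' => h.trans_le (hr hi')⟩
    by_contra hi
    have := hn i (by omega)
    omega

lemma eq_of_rowLen_eq {ρ σ : YoungDiagram} (h : ∀ i, ρ.rowLen i = σ.rowLen i) : ρ = σ :=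
  le_antisymm (le_iff_rowLen_le.mpr fun i => (h i).le) (le_iff_rowLen_le.mpr fun i => (h i).ge)

lemma lrCoeff_ne_zero {α μ ρ : YoungDiagram} (h : lrCoeff α μ ρ ≠ 0) :
    α ≤ ρ ∧ μ ≤ ρ ∧ ρ.card = α.card + μ.card := by
  have hle : α ≤ ρ := by
    by_contra hle
    exact h (if_neg hle)
  set n := ρ.card + μ.card with hn
  have hρ : ∀ i, n ≤ i → ρ.rowLen i = 0 := fun i hi => rowLen_eq_zero (by omega)
  have hμ : ∀ i, n ≤ i → μ.rowLen i = 0 := fun i hi => rowLen_eq_zero (by omega)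
  rw [lrCoeff_eq_card hρ, ← Nat.pos_iff_ne_zero, Finset.card_pos] at h
  obtain ⟨t, ht⟩ := h
  obtain ⟨ht, hv, hw⟩ := mem_lrSet.mp ht
  refine ⟨hle, le_iff_rowLen_le.mpr fun k => ?_, ?_⟩
  · have h1 := ht.le_ofPattern hv (i := max n k) (le_max_right _ _)
    rw [ht.ofPattern_eq _ le_rfl, ← hw, ht.2.1 _ (by omega)] at h1
    omega
  · rw [card_eq_sum ρ hρ, card_eq_sum α (n := n), card_eq_sum μ hμ]
    · simp only [hw, Finset.sum_add_distrib]
      rw [ht.sum_wt, psum, ht.2.1 n le_rfl]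
    · intro i hi
      have := hw i
      rw [hρ i hi] at this
      omega

lemma sum_lrCoeff (B : ℕ → ℚ) (α μ : YoungDiagram) {n : ℕ} (hn : α.card + μ.card ≤ n) :
    (Matrix.of fun i j : Fin n =>
      B (α.rowLen i + (n - 1 - i) + (μ.rowLen (n - 1 - j) + j))).det =
    ∑ᶠ ρ : YoungDiagram, (lrCoeff α μ ρ : ℚ) *
      (Matrix.of fun i j : Fin n => B (ρ.rowLen i + (n - 1 - i) + j)).det := by
  have hα : ∀ i, n ≤ i → α.rowLen i = 0 := fun i hi => rowLen_eq_zero (by omega)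
  have hμ : ∀ i, n ≤ i → μ.rowLen i = 0 := fun i hi => rowLen_eq_zero (by omega)
  have h1 := det_hankel_eq_sum B n μ.rowLen (fun i => α.rowLen i + (n - 1 - i))
    (fun a b h => μ.rowLen_anti a b h) hμ
  have h2 := sum_det_eq_sum_filter B n μ.rowLen α.rowLen (fun a b h => α.rowLen_anti a b h) hα
  rw [h1, h2]
  let diag : (ℕ → ℕ → ℕ) → YoungDiagram := fun t => rowsDiagram n fun i => α.rowLen i + wt t i
  set G := (gtSet n μ.rowLen).filter (fun t => ∀ i k, ¬ Viol α.rowLen t i k) with hG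
  have hdiag : ∀ t ∈ G, ∀ i, (diag t).rowLen i = α.rowLen i + wt t i := by
    intro t ht i
    rw [hG, Finset.mem_filter, mem_gtSet] at ht
    refine rowLen_rowsDiagram (antitone_nat_of_succ_le fun i => ?_) (fun i hi => ?_) i
    · have h := (ht.1.viol_iff (a := α.rowLen) i (i + 1)).not.mp (ht.2 _ _)
      rwa [ht.1.ofPattern_eq _ le_rfl, ht.1.ofPattern_eq _ le_rfl, not_lt] at h
    · have h : psm (t i) (i + 1) + wt t i = psm (t (i + 1)) (i + 1) := ht.1.psum_add_wt le_rfl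
      rw [ht.1.2.1 i hi, ht.1.2.1 (i + 1) (by omega)] at h
      have := hα i hi
      omega
  have h3 : ∀ t ∈ G,
      (Matrix.of fun i j : Fin n => B (α.rowLen i + (n - 1 - i) + wt t i + j)).det =
      (Matrix.of fun i j : Fin n => B ((diag t).rowLen i + (n - 1 - i) + j)).det := by
    intro t ht
    congr 1
    ext i j
    simp only [Matrix.of_apply]
    rw [hdiag t ht]
    congr 1
    ring
  have h4 : ∀ ρ, (∀ i, n ≤ i → ρ.rowLen i = 0) →
      lrCoeff α μ ρ = (G.filter (fun t => diag t = ρ)).card := by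
    intro ρ hρ
    rw [lrCoeff_eq_card hρ]
    congr 1
    ext t
    have hmem : t ∈ G ↔ t ∈ gtSet n μ.rowLen ∧ ∀ i k, ¬ Viol α.rowLen t i k := Finset.mem_filter
    rw [mem_lrSet, Finset.mem_filter, ← mem_gtSet, ← and_assoc, ← hmem]
    refine and_congr_right fun ht => ⟨fun h => eq_of_rowLen_eq fun i => ?_, fun h i => ?_⟩
    · rw [hdiag t ht, h]
    · rw [← h, hdiag t ht]
  rw [Finset.sum_congr rfl h3, Finset.sum_comp
    (fun ρ => (Matrix.of fun i j : Fin n => B (ρ.rowLen i + (n - 1 - i) + j)).det) diag,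
    finsum_eq_sum_of_support_subset (s := G.image diag)]
  · refine Finset.sum_congr rfl fun ρ hρ => ?_
    obtain ⟨t, ht, rfl⟩ := Finset.mem_image.mp hρ
    rw [h4, nsmul_eq_mul]
    intro i hi
    rw [hG, Finset.mem_filter, mem_gtSet] at ht
    rw [hdiag t (by rw [hG, Finset.mem_filter, mem_gtSet]; exact ht)]
    have h : psm (t i) (i + 1) + wt t i = psm (t (i + 1)) (i + 1) := ht.1.psum_add_wt le_rfl
    rw [ht.1.2.1 i hi, ht.1.2.1 (i + 1) (by omega)] at h
    have := hα i hi
    omega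
  · intro ρ hρ
    have hne : lrCoeff α μ ρ ≠ 0 := by
      intro h
      exact hρ (by simp [h])
    have hcard := (lrCoeff_ne_zero hne).2.2
    rw [h4 ρ (fun i hi => rowLen_eq_zero (by omega)), ← Nat.pos_iff_ne_zero,
      Finset.card_pos] at hne
    obtain ⟨t, ht⟩ := hne
    rw [Finset.mem_filter] at ht
    exact Finset.mem_coe.mpr (Finset.mem_image.mpr ⟨t, ht.1, ht.2⟩)

section Transpose

lemma skewContPoly_transpose (x : ℚ) (ρ σ : YoungDiagram) :
    skewContPoly x ρ.transpose σ.transpose =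
      (-1) ^ (ρ.cells \ σ.cells).card * skewContPoly (-x) ρ σ := by
  rw [skewContPoly, skewContPoly, ← Finset.prod_const, ← Finset.prod_mul_distrib]
  refine Finset.prod_nbij' Prod.swap Prod.swap ?_ ?_ ?_ ?_ ?_
  · intro c hc
    simpa [YoungDiagram.mem_transpose] using hc
  · intro c hc
    simpa [YoungDiagram.mem_transpose] using hc
  · exact fun c _ => c.swap_swap
  · exact fun c _ => c.swap_swap
  · intro c _
    simp only [Prod.fst_swap, Prod.snd_swap]
    ring

lemma hookProd_transpose (ρ : YoungDiagram) : hookProd ρ.transpose = hookProd ρ := by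
  rw [hookProd, hookProd]
  refine Finset.prod_nbij' Prod.swap Prod.swap ?_ ?_ ?_ ?_ ?_
  · intro c hc
    simpa [YoungDiagram.mem_transpose] using hc
  · intro c hc
    simpa [YoungDiagram.mem_transpose] using hc
  · exact fun c _ => c.swap_swap
  · exact fun c _ => c.swap_swap
  · intro c _
    simp only [Prod.fst_swap, Prod.snd_swap, YoungDiagram.rowLen_transpose,
      YoungDiagram.colLen_transpose]
    congr 1
    omega

lemma P_eq_finsum (lam mu : YoungDiagram) (e f : ℚ) :
    P lam mu e f = ∑ᶠ ρ : YoungDiagram, (-1) ^ mu.card * ((lrCoeff lam.transpose mu ρ : ℚ) *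
      skewContPoly (-e) ρ lam.transpose * skewContPoly f ρ mu / hookProd ρ) := by
  rw [P, ← finsum_comp_equiv YoungDiagram.transposeOrderIso.toEquiv]
  refine finsum_congr fun ρ => ?_
  change (lrCoeff lam.transpose mu ρ.transpose.transpose : ℚ) * skewContPoly e ρ.transpose lam *
    skewContPoly f ρ.transpose.transpose mu / hookProd ρ.transpose = _
  rw [YoungDiagram.transpose_transpose, hookProd_transpose]
  by_cases h : lrCoeff lam.transpose mu ρ = 0
  · simp [h]
  obtain ⟨h1, _, h2⟩ := lrCoeff_ne_zero h
  have h3 := skewContPoly_transpose e ρ lam.transpose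
  rw [YoungDiagram.transpose_transpose, Finset.card_sdiff_of_subset
    (YoungDiagram.cells_subset_iff.mpr h1)] at h3
  change skewContPoly e ρ.transpose lam = (-1) ^ (ρ.card - lam.transpose.card) * _ at h3
  rw [h3, h2, Nat.add_sub_cancel_left]
  ring

end Transpose

section Evaluation

variable {n : ℕ} {ρ σ : YoungDiagram}

lemma skewContPoly_mul (x : ℚ) (h : σ ≤ ρ) :
    skewContPoly x ρ σ * contPoly x σ = contPoly x ρ :=
  Finset.prod_sdiff (YoungDiagram.cells_subset_iff.mpr h)

lemma contPoly_mul (p : ℕ) (hn : ∀ i, n ≤ i → ρ.rowLen i = 0) :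
    contPoly ((n : ℚ) + p) ρ * ∏ i : Fin n, ((n - 1 - i + p).factorial : ℚ) =
      ∏ i : Fin n, ((ρ.rowLen i + (n - 1 - i) + p).factorial : ℚ) := by
  rw [contPoly, prod_cells ρ hn, Finset.prod_range, ← Finset.prod_mul_distrib]
  refine Finset.prod_congr rfl fun i _ => ?_
  have key : ∀ (a r : ℕ), (∏ j ∈ Finset.range r, ((a : ℚ) + 1 + j)) * (a.factorial : ℚ) =
      ((r + a).factorial : ℚ) := by
    intro a r
    induction r with
    | zero => simp
    | succ r ih =>
      rw [Finset.prod_range_succ, mul_right_comm, ih, show r + 1 + a = (r + a) + 1 by ring,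
        Nat.factorial_succ]
      push_cast
      ring
  rw [add_assoc, ← key (n - 1 - i + p)]
  congr 1
  refine Finset.prod_congr rfl fun j _ => ?_
  have h1 : ((n - 1 - (i : ℕ) : ℕ) : ℚ) = n - 1 - i := by
    have := i.2
    rw [Nat.cast_sub (by omega), Nat.cast_sub (by omega)]
    simp
  push_cast
  rw [h1]
  ring

/-- The shifted row lengths of a partition, in decreasing order. -/
def shifted (n : ℕ) (ρ : YoungDiagram) (i : Fin n) : ℕ := ρ.rowLen i + (n - 1 - i)

lemma shifted_lt {i j : Fin n} (h : i < j) : shifted n ρ j < shifted n ρ i := by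
  have := ρ.rowLen_anti i j (le_of_lt h)
  have h1 : (i : ℕ) < j := h
  have h2 := j.2
  unfold shifted
  omega

lemma prod_hook_row (ρ : YoungDiagram) (i : Fin n) (hn : ∀ i, n ≤ i → ρ.rowLen i = 0) :
    (∏ c ∈ Finset.range (ρ.rowLen i), (ρ.rowLen i + ρ.colLen c - i - c - 1)) *
      ∏ j ∈ Finset.Ioi i, (shifted n ρ i - shifted n ρ j) = (shifted n ρ i).factorial := by
  have hcol : ∀ c < ρ.rowLen i, (i : ℕ) < ρ.colLen c ∧ ρ.colLen c ≤ n := by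
    intro c hc
    refine ⟨YoungDiagram.mem_iff_lt_colLen.mp (YoungDiagram.mem_iff_lt_rowLen.mpr hc), ?_⟩
    by_contra hlt
    have := YoungDiagram.mem_iff_lt_rowLen.mp (YoungDiagram.mem_iff_lt_colLen.mpr (not_le.mp hlt))
    rw [hn n le_rfl] at this
    omega
  let φ : ℕ ⊕ Fin n → ℕ :=
    Sum.elim (fun c => ρ.rowLen i + ρ.colLen c - i - c - 1) (fun j => shifted n ρ i - shifted n ρ j)
  set S := (Finset.range (ρ.rowLen i)).disjSum (Finset.Ioi i) with hS
  have hmaps : Set.MapsTo φ S (Finset.Ico 1 (shifted n ρ i + 1)) := by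
    rintro (c | j) hx
    · simp only [hS, Finset.mem_coe, Finset.inl_mem_disjSum, Finset.mem_range] at hx
      have := hcol c hx
      simp only [φ, Sum.elim_inl, Finset.coe_Ico, Set.mem_Ico, shifted]
      omega
    · simp only [hS, Finset.mem_coe, Finset.inr_mem_disjSum, Finset.mem_Ioi] at hx
      have := shifted_lt (ρ := ρ) hx
      simp only [φ, Sum.elim_inr, Finset.coe_Ico, Set.mem_Ico]
      omega
  have hne : ∀ c < ρ.rowLen i, ∀ j, i < j →
      ρ.rowLen i + ρ.colLen c - i - c - 1 ≠ shifted n ρ i - shifted n ρ j := by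
    intro c hc j hj
    have h1 := hcol c hc
    have h2 := ρ.rowLen_anti i j (le_of_lt hj)
    have h3 : (i : ℕ) < j := hj
    have h4 := j.2
    have h5 : c < ρ.rowLen j ↔ (j : ℕ) < ρ.colLen c := by
      rw [← YoungDiagram.mem_iff_lt_rowLen, YoungDiagram.mem_iff_lt_colLen]
    unfold shifted
    by_cases h : c < ρ.rowLen j
    · have := h5.mp h
      omega
    · have := h5.not.mp h
      omega
  have hinj : Set.InjOn φ S := by
    rintro (c | j) hx (c' | j') hy heq
    · simp only [hS, Finset.mem_coe, Finset.inl_mem_disjSum, Finset.mem_range] at hx hy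
      simp only [φ, Sum.elim_inl] at heq
      have h1 := hcol c hx
      have h2 := hcol c' hy
      congr 1
      rcases lt_trichotomy c c' with h | h | h
      · have := ρ.colLen_anti c c' h.le
        omega
      · exact h
      · have := ρ.colLen_anti c' c h.le
        omega
    · simp only [hS, Finset.mem_coe, Finset.inl_mem_disjSum, Finset.inr_mem_disjSum,
        Finset.mem_range, Finset.mem_Ioi] at hx hy
      exact absurd heq (hne c hx j' hy)
    · simp only [hS, Finset.mem_coe, Finset.inl_mem_disjSum, Finset.inr_mem_disjSum,
        Finset.mem_range, Finset.mem_Ioi] at hx hy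
      exact absurd heq.symm (hne c' hy j hx)
    · simp only [hS, Finset.mem_coe, Finset.inr_mem_disjSum, Finset.mem_Ioi] at hx hy
      simp only [φ, Sum.elim_inr] at heq
      have h1 := shifted_lt (ρ := ρ) hx
      have h2 := shifted_lt (ρ := ρ) hy
      congr 1
      rcases lt_trichotomy j j' with h | h | h
      · have := shifted_lt (ρ := ρ) h
        omega
      · exact h
      · have := shifted_lt (ρ := ρ) h
        omega
  have hcard : S.card = shifted n ρ i := by
    rw [hS, Finset.card_disjSum, Finset.card_range, Fin.card_Ioi, shifted]
  have himage : S.image φ = Finset.Ico 1 (shifted n ρ i + 1) := by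
    refine Finset.eq_of_subset_of_card_le ?_ ?_
    · intro x hx
      obtain ⟨y, hy, rfl⟩ := Finset.mem_image.mp hx
      exact hmaps hy
    · rw [Finset.card_image_of_injOn hinj, hcard, Nat.card_Ico, Nat.add_sub_cancel]
  rw [← Finset.prod_Ico_id_eq_factorial, ← himage, Finset.prod_image hinj, hS,
    Finset.prod_disjSum]
  rfl

lemma hookProd_mul (ρ : YoungDiagram) (hn : ∀ i, n ≤ i → ρ.rowLen i = 0) :
    hookProd ρ * ∏ i : Fin n, ∏ j ∈ Finset.Ioi i, ((shifted n ρ i : ℚ) - shifted n ρ j) =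
      ∏ i : Fin n, ((shifted n ρ i).factorial : ℚ) := by
  rw [hookProd, prod_cells ρ hn, Finset.prod_range, ← Finset.prod_mul_distrib]
  refine Finset.prod_congr rfl fun i _ => ?_
  rw [← prod_hook_row ρ i hn, Nat.cast_mul, Nat.cast_prod, Nat.cast_prod]
  congr 1
  refine Finset.prod_congr rfl fun j hj => ?_
  rw [Nat.cast_sub (shifted_lt (Finset.mem_Ioi.mp hj)).le]

/-- The sign of the reversal of `n` rows. -/
def revSign (n : ℕ) : ℚ := ∏ i : Fin n, ∏ _j ∈ Finset.Ioi i, (-1)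

lemma revSign_ne_zero (n : ℕ) : revSign n ≠ 0 :=
  Finset.prod_ne_zero_iff.mpr fun _ _ => Finset.prod_ne_zero_iff.mpr fun _ _ => by norm_num

lemma det_factorial (N : Fin n → ℕ) (p : ℕ) :
    (Matrix.of fun i j : Fin n => ((N i + j + p).factorial : ℚ)).det =
      revSign n * ((∏ i, ((N i + p).factorial : ℚ)) *
        ∏ i, ∏ j ∈ Finset.Ioi i, ((N i : ℚ) - N j)) := by
  have h := Matrix.det_eval_matrixOfPolynomials_eq_det_vandermonde
    (fun i => ((N i + p + 1 : ℕ) : ℚ)) (fun j : Fin n => ascPochhammer ℚ j)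
    (fun j => ascPochhammer_natDegree ℚ j) (fun j => monic_ascPochhammer ℚ j)
  have h2 := Matrix.det_mul_column (fun i => ((N i + p).factorial : ℚ))
    (Matrix.of fun i j : Fin n => (ascPochhammer ℚ j).eval ((N i + p + 1 : ℕ) : ℚ))
  rw [← h, Matrix.det_vandermonde] at h2
  rw [mul_left_comm, revSign, ← Finset.prod_mul_distrib]
  simp only [← Finset.prod_mul_distrib]
  convert h2 using 2
  · ext i j
    simp only [Matrix.of_apply]
    rw [← Nat.cast_ascFactorial, ← Nat.cast_mul, Nat.factorial_mul_ascFactorial]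
    congr 2
    ring
  · rw [← Finset.prod_mul_distrib]
    refine Finset.prod_congr rfl fun i _ => congrArg _ (Finset.prod_congr rfl fun j _ => ?_)
    push_cast
    ring

end Evaluation

section Evaluation

variable {n : ℕ} {ρ σ : YoungDiagram}

lemma skewContPoly_mul_factorial (p : ℕ) (h : σ ≤ ρ) (hn : ∀ i, n ≤ i → ρ.rowLen i = 0) :
    skewContPoly ((n : ℚ) + p) ρ σ * ∏ i : Fin n, ((shifted n σ i + p).factorial : ℚ) =
      ∏ i : Fin n, ((shifted n ρ i + p).factorial : ℚ) := by
  have hσ : ∀ i, n ≤ i → σ.rowLen i = 0 := fun i hi => by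
    have := le_iff_rowLen_le.mp h i
    rw [hn i hi] at this
    omega
  have h1 := contPoly_mul p hn
  have h2 := contPoly_mul p hσ
  simp only [shifted]
  rw [← h1, ← h2, ← mul_assoc, skewContPoly_mul _ h]

lemma shifted_rev (μ : YoungDiagram) (j : Fin n) :
    shifted n μ (Fin.rev j) = μ.rowLen (n - 1 - j) + j := by
  have := j.2
  rw [shifted, Fin.val_rev, show n - (j + 1) = n - 1 - (j : ℕ) by omega]
  omega

lemma det_factorial_eq_choose (a m : Fin n → ℕ) :
    (Matrix.of fun i j : Fin n => ((a i + m j).factorial : ℚ)).det =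
      (∏ i, ((a i).factorial : ℚ)) * ((∏ j, ((m j).factorial : ℚ)) *
        (Matrix.of fun i j : Fin n => ((a i + m j).choose (m j) : ℚ)).det) := by
  rw [← Matrix.det_mul_row, ← Matrix.det_mul_column]
  congr 1
  ext i j
  simp only [Matrix.of_apply]
  rw [← Nat.add_choose_mul_factorial_mul_factorial]
  push_cast
  ring

lemma P_eq_det (lam mu : YoungDiagram) (p : ℕ) (hn : lam.transpose.card + mu.card ≤ n) :
    revSign n * P lam mu (-((n : ℚ) + p)) n = (-1) ^ mu.card *
      (Matrix.of fun i j : Fin n => ((shifted n lam.transpose i + p + shifted n mu j.rev).choose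
        (shifted n mu j.rev) : ℚ)).det := by
  set α := lam.transpose with hα
  set A := ∏ i : Fin n, ((shifted n α i + p).factorial : ℚ) with hA
  set M := ∏ i : Fin n, ((shifted n mu i).factorial : ℚ) with hM
  have hA0 : A ≠ 0 := Finset.prod_ne_zero_iff.mpr fun i _ => by positivity
  have hM0 : M ≠ 0 := Finset.prod_ne_zero_iff.mpr fun i _ => by positivity
  have h1 := sum_lrCoeff (fun a => ((a + p).factorial : ℚ)) α mu hn
  have h2 := det_factorial_eq_choose (fun i => shifted n α i + p) (fun j => shifted n mu j.rev)
  have hMrev : ∏ j : Fin n, ((shifted n mu j.rev).factorial : ℚ) = M :=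
    Equiv.prod_comp Fin.revPerm fun j => ((shifted n mu j).factorial : ℚ)
  rw [hMrev] at h2
  have h3 : (Matrix.of fun i j : Fin n =>
      ((shifted n α i + p + shifted n mu j.rev).factorial : ℚ)).det =
      (Matrix.of fun i j : Fin n =>
        ((α.rowLen i + (n - 1 - i) + (mu.rowLen (n - 1 - j) + j) + p).factorial : ℚ)).det := by
    congr 1
    ext i j
    simp only [Matrix.of_apply]
    rw [shifted_rev, shifted]
    congr 2
    ring
  rw [h3, h1] at h2
  refine mul_left_cancel₀ (mul_ne_zero hA0 hM0) ?_
  rw [mul_left_comm (A * M) ((-1) ^ _), mul_assoc A M (Matrix.det _), ← h2, P_eq_finsum, mul_finsum,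
    mul_finsum, mul_finsum]
  refine finsum_congr fun ρ => ?_
  by_cases h : lrCoeff α mu ρ = 0
  · simp [h, ← hα]
  obtain ⟨h4, h5, h6⟩ := lrCoeff_ne_zero h
  have hρ : ∀ i, n ≤ i → ρ.rowLen i = 0 := fun i hi => rowLen_eq_zero (by omega)
  have e1 := skewContPoly_mul_factorial p h4 hρ
  have e2 := skewContPoly_mul_factorial 0 h5 hρ
  have e3 := hookProd_mul ρ hρ
  have e4 := det_factorial (fun i => shifted n ρ i) p
  simp only [Nat.cast_zero, add_zero] at e2
  rw [← hA] at e1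
  rw [← hM, ← e3] at e2
  have h0 : hookProd ρ ≠ 0 := by
    intro h0
    rw [h0, zero_mul, eq_comm, Finset.prod_eq_zero_iff] at e3
    obtain ⟨i, _, hi⟩ := e3
    exact absurd hi (by positivity)
  change _ = _ * (_ * (Matrix.of fun i j : Fin n =>
    ((shifted n ρ i + j + p).factorial : ℚ)).det)
  rw [e4, ← e1, neg_neg, ← hα]
  field_simp
  linear_combination (revSign n * skewContPoly (n + p) ρ α) * e2

/-- The determinant of binomial coefficients attached to a partition. -/
def chooseDet (n : ℕ) (a : Fin n → ℕ) (μ : YoungDiagram) : ℚ :=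
  (Matrix.of fun i j : Fin n => ((a i + shifted n μ j).choose (shifted n μ j) : ℚ)).det

lemma exists_P_eq_chooseDet (n : ℕ) : ∃ c : ℚ, c ≠ 0 ∧ ∀ (lam mu : YoungDiagram) (p : ℕ),
    lam.transpose.card + mu.card ≤ n → c * P lam mu (-((n : ℚ) + p)) n =
      (-1) ^ mu.card * chooseDet n (fun i => shifted n lam.transpose i + p) mu := by
  refine ⟨(Equiv.Perm.sign (Fin.revPerm (n := n)) : ℤ) * revSign n,
    mul_ne_zero (by simp) (revSign_ne_zero n), fun lam mu p hn => ?_⟩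
  rw [mul_assoc, P_eq_det lam mu p hn, mul_left_comm, chooseDet]
  congr 1
  have h := Matrix.det_permute' (Fin.revPerm (n := n)) (Matrix.of fun i j : Fin n =>
    ((shifted n lam.transpose i + p + shifted n mu j.rev).choose (shifted n mu j.rev) : ℚ))
  rw [← h]
  congr 1
  ext i j
  simp

end Evaluation

section VerticalStrip

lemma det_col_sub {n : ℕ} (F G : Fin n → Fin n → ℚ) :
    (Matrix.of fun i j => F i j - G i j).det = ∑ S : Finset (Fin n),
      (-1) ^ S.card * (Matrix.of fun i j => if j ∈ S then G i j else F i j).det := by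
  let D := (Matrix.detRowAlternating (n := Fin n) (R := ℚ)).toMultilinearMap
  have hD : ∀ M : Fin n → Fin n → ℚ, D M = (Matrix.of fun i j => M j i).det := fun M =>
    (Matrix.det_transpose (Matrix.of M)).symm
  have h := D.map_add_univ (fun j i => (-1 : ℚ) • G i j) (fun j i => F i j)
  have h1 : ((fun j i => (-1 : ℚ) • G i j) + fun j i => F i j) = fun j i => F i j - G i j := by
    funext j i
    simp only [Pi.add_apply, smul_eq_mul]
    ring
  rw [h1, hD] at h
  rw [h]
  refine Finset.sum_congr rfl fun S _ => ?_
  have h2 := D.map_piecewise_smul (fun _ => (-1 : ℚ))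
    (fun j i => if j ∈ S then G i j else F i j) S
  rw [Finset.prod_const, smul_eq_mul, hD (fun j i => if j ∈ S then G i j else F i j)] at h2
  rw [← h2]
  congr 1
  funext j i
  by_cases hj : j ∈ S <;> simp [hj, Finset.piecewise]

/-- The partitions obtained from `μ` by removing a vertical strip. -/
def vstrip (μ : YoungDiagram) : Finset YoungDiagram :=
  Set.Finite.toFinset (s := {θ | θ ≤ μ ∧ ∀ i, μ.rowLen i ≤ θ.rowLen i + 1}) <| by
    have hinj : Function.Injective YoungDiagram.cells := fun a b h => YoungDiagram.ext h
    refine (Set.Finite.preimage hinj.injOn (Finset.finite_toSet μ.cells.powerset)).subset ?_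
    intro θ hθ
    simpa using hθ.1

lemma mem_vstrip {μ θ : YoungDiagram} :
    θ ∈ vstrip μ ↔ θ ≤ μ ∧ ∀ i, μ.rowLen i ≤ θ.rowLen i + 1 := by
  simp [vstrip]

variable {n : ℕ} {μ θ : YoungDiagram}

/-- The rows from which a box is removed. -/
def stripRows (n : ℕ) (μ θ : YoungDiagram) : Finset (Fin n) :=
  Finset.univ.filter fun r => θ.rowLen r < μ.rowLen r

lemma mem_stripRows {r : Fin n} : r ∈ stripRows n μ θ ↔ θ.rowLen r < μ.rowLen r := by
  simp [stripRows]

lemma rowLen_add_of_mem_vstrip (h : θ ∈ vstrip μ) (r : Fin n) :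
    θ.rowLen r + (if r ∈ stripRows n μ θ then 1 else 0) = μ.rowLen r := by
  have h1 := le_iff_rowLen_le.mp (mem_vstrip.mp h).1 r
  have h2 := (mem_vstrip.mp h).2 r
  have h3 := mem_stripRows (μ := μ) (θ := θ) (r := r)
  split_ifs with h4
  · have := h3.mp h4
    omega
  · have := h3.not.mp h4
    omega

lemma card_add_of_mem_vstrip (h : θ ∈ vstrip μ) (hn : ∀ i, n ≤ i → μ.rowLen i = 0) :
    θ.card + (stripRows n μ θ).card = μ.card := by
  have hθ : ∀ i, n ≤ i → θ.rowLen i = 0 := fun i hi => by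
    have := le_iff_rowLen_le.mp (mem_vstrip.mp h).1 i
    rw [hn i hi] at this
    omega
  rw [card_eq_sum θ hθ, card_eq_sum μ hn, Finset.sum_range, Finset.sum_range]
  simp only [← rowLen_add_of_mem_vstrip h, Finset.sum_add_distrib]
  simp

lemma stripRows_injOn (hn : ∀ i, n ≤ i → μ.rowLen i = 0) :
    Set.InjOn (stripRows n μ) (vstrip μ : Set YoungDiagram) := by
  intro θ hθ θ' hθ' heq
  refine eq_of_rowLen_eq fun i => ?_
  by_cases hi : i < n
  · have h1 := rowLen_add_of_mem_vstrip hθ ⟨i, hi⟩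
    have h2 := rowLen_add_of_mem_vstrip hθ' ⟨i, hi⟩
    rw [heq] at h1
    simp only at h1 h2
    omega
  · have h1 := le_iff_rowLen_le.mp (mem_vstrip.mp hθ).1 i
    have h2 := le_iff_rowLen_le.mp (mem_vstrip.mp hθ').1 i
    rw [hn i (by omega)] at h1 h2
    omega

/-- A set of rows from which a box can be removed simultaneously. -/
lemma exists_stripRows_eq (hn : ∀ i, n ≤ i → μ.rowLen i = 0) (S : Finset (Fin n))
    (hS : ∀ r ∈ S, μ.rowLen (r + 1) = μ.rowLen r → ∃ h : (r : ℕ) + 1 < n, ⟨r + 1, h⟩ ∈ S) :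
    ∃ θ ∈ vstrip μ, stripRows n μ θ = S := by
  have hpos : ∀ d (r : Fin n), n - r ≤ d → r ∈ S → μ.rowLen r ≠ 0 := by
    intro d
    induction d with
    | zero =>
      intro r hr
      have := r.2
      omega
    | succ d ih =>
      intro r hr hrS h0
      have h1 := μ.rowLen_anti r (r + 1) (Nat.le_succ _)
      obtain ⟨h2, h3⟩ := hS r hrS (by omega)
      exact ih ⟨r + 1, h2⟩ (by simp only; omega) h3 (by simp only; omega)
  let b : ℕ → ℕ := fun i => if ∃ h : i < n, ⟨i, h⟩ ∈ S then 1 else 0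
  have hb1 : ∀ i, b i ≤ 1 := fun i => by
    simp only [b]
    split_ifs <;> omega
  have hbS : ∀ r : Fin n, b r = 1 ↔ r ∈ S := fun r => by simp [b]
  have hlen : ∀ i, (rowsDiagram n fun i => μ.rowLen i - b i).rowLen i = μ.rowLen i - b i := by
    refine rowLen_rowsDiagram (antitone_nat_of_succ_le fun i => ?_) fun i hi => by
      simp [hn i hi]
    have h1 := μ.rowLen_anti i (i + 1) (Nat.le_succ _)
    by_cases h : ∃ h : i < n, ⟨i, h⟩ ∈ S
    · obtain ⟨hi, hiS⟩ := h
      by_cases heq : μ.rowLen (i + 1) = μ.rowLen i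
      · obtain ⟨h2, h3⟩ := hS _ hiS heq
        have h4 := (hbS _).mpr h3
        simp only at h4
        have := hb1 i
        omega
      · have := hb1 i
        omega
    · have : b i = 0 := if_neg h
      omega
  refine ⟨rowsDiagram n fun i => μ.rowLen i - b i, mem_vstrip.mpr
    ⟨le_iff_rowLen_le.mpr fun i => ?_, fun i => ?_⟩, ?_⟩
  · rw [hlen]
    omega
  · have := hb1 i
    rw [hlen]
    omega
  · ext r
    rw [mem_stripRows, hlen, ← hbS]
    constructor
    · intro h
      have := hb1 r
      omega
    · intro h
      have := hpos (n - r) r le_rfl ((hbS r).mp h)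
      omega

lemma chooseDet_recursion (a : Fin n → ℕ) (hn : ∀ i, n ≤ i → μ.rowLen i = 0) :
    (-1) ^ μ.card * chooseDet n a μ =
      ∑ θ ∈ vstrip μ, (-1) ^ θ.card * chooseDet n (fun i => a i + 1) θ := by
  let F : Fin n → Fin n → ℚ := fun i j =>
    ((a i + 1 + shifted n μ j).choose (shifted n μ j) : ℚ)
  let G : Fin n → Fin n → ℚ := fun i j => if shifted n μ j = 0 then 0 else
    ((a i + 1 + (shifted n μ j - 1)).choose (shifted n μ j - 1) : ℚ)
  have h1 : chooseDet n a μ = (Matrix.of fun i j => F i j - G i j).det := by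
    rw [chooseDet]
    congr 1
    ext i j
    simp only [Matrix.of_apply, F, G]
    rcases Nat.eq_zero_or_pos (shifted n μ j) with h | h
    · simp [h]
    · obtain ⟨m, hm⟩ := Nat.exists_eq_succ_of_ne_zero h.ne'
      rw [hm, if_neg (Nat.succ_ne_zero m), Nat.succ_eq_add_one, Nat.add_sub_cancel,
        show a i + 1 + (m + 1) = (a i + (m + 1)) + 1 by ring,
        Nat.choose_succ_succ, show a i + 1 + m = a i + (m + 1) by ring]
      push_cast
      ring
  rw [h1, det_col_sub, Finset.mul_sum, eq_comm]
  refine Finset.sum_of_injOn (stripRows n μ) (stripRows_injOn hn) (fun _ _ => by simp) ?_ ?_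
  · intro S _ hS
    have hbad : ¬ ∀ r ∈ S, μ.rowLen (r + 1) = μ.rowLen r →
        ∃ h : (r : ℕ) + 1 < n, ⟨r + 1, h⟩ ∈ S := by
      intro hgood
      obtain ⟨θ, hθ, rfl⟩ := exists_stripRows_eq hn S hgood
      exact hS ⟨θ, hθ, rfl⟩
    push Not at hbad
    obtain ⟨r, hr, heq, hr1⟩ := hbad
    have hdet : (Matrix.of fun i j => if j ∈ S then G i j else F i j).det = 0 := by
      by_cases hlt : (r : ℕ) + 1 < n
      · refine Matrix.det_zero_of_column_eq (i := r) (j := ⟨r + 1, hlt⟩)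
          (fun h => by simpa using congrArg Fin.val h) fun i => ?_
        simp only [Matrix.of_apply, hr, hr1 hlt, if_true, if_false, F, G]
        have h2 : shifted n μ r = shifted n μ ⟨r + 1, hlt⟩ + 1 := by
          simp only [shifted]
          omega
        rw [h2, if_neg (Nat.succ_ne_zero _), Nat.add_sub_cancel]
      · refine Matrix.det_eq_zero_of_column_eq_zero r fun i => ?_
        have h2 : shifted n μ r = 0 := by
          rw [hn _ (by omega)] at heq
          have := r.2
          rw [shifted]
          omega
        simp [hr, G, h2]
    rw [hdet, mul_zero, mul_zero]
  · intro θ hθ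
    have hcard := card_add_of_mem_vstrip hθ hn
    have hsign : (-1 : ℚ) ^ μ.card * (-1) ^ (stripRows n μ θ).card = (-1) ^ θ.card := by
      rw [← hcard, pow_add, mul_assoc, ← mul_pow]
      simp
    rw [← mul_assoc, hsign, chooseDet]
    congr 2
    ext i j
    simp only [Matrix.of_apply, F, G]
    have h2 := rowLen_add_of_mem_vstrip hθ j
    split_ifs at h2 ⊢ with h3 h4
    · rw [shifted] at h4
      omega
    · have h5 : shifted n μ j = shifted n θ j + 1 := by
        simp only [shifted]
        omega
      rw [h5, Nat.add_sub_cancel]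
    · have h5 : shifted n μ j = shifted n θ j := by
        simp only [shifted]
        omega
      rw [h5]

end VerticalStrip

section PolynomialExtension

/-- A polynomial function. -/
def IsPoly (F : ℚ → ℚ) : Prop := ∃ q : Polynomial ℚ, ∀ x, F x = q.eval x

lemma IsPoly.sum {ι : Type*} {s : Finset ι} {F : ι → ℚ → ℚ} (h : ∀ i ∈ s, IsPoly (F i)) :
    IsPoly fun x => ∑ i ∈ s, F i x := by
  choose! q hq using h
  refine ⟨∑ i ∈ s, q i, fun x => ?_⟩
  rw [Polynomial.eval_finsetSum]
  exact Finset.sum_congr rfl fun i hi => hq i hi x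

lemma IsPoly.const_mul {F : ℚ → ℚ} (h : IsPoly F) (c : ℚ) : IsPoly fun x => c * F x := by
  obtain ⟨q, hq⟩ := h
  exact ⟨Polynomial.C c * q, fun x => by simp [hq]⟩

lemma IsPoly.comp {F : ℚ → ℚ} (h : IsPoly F) (r : Polynomial ℚ) :
    IsPoly fun x => F (r.eval x) := by
  obtain ⟨q, hq⟩ := h
  exact ⟨q.comp r, fun x => by simp only [hq, Polynomial.eval_comp]⟩

lemma IsPoly.ext {F G : ℚ → ℚ} (hF : IsPoly F) (hG : IsPoly G) {u : ℕ → ℚ}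
    (hu : Function.Injective u) (h : ∀ k, F (u k) = G (u k)) (x : ℚ) : F x = G x := by
  obtain ⟨p, hp⟩ := hF
  obtain ⟨q, hq⟩ := hG
  have : p = q := by
    refine Polynomial.eq_of_infinite_eval_eq p q ((Set.infinite_range_of_injective hu).mono ?_)
    rintro _ ⟨k, rfl⟩
    change p.eval (u k) = q.eval (u k)
    rw [← hp, ← hq, h]
  rw [hp, hq, this]

lemma isPoly_skewContPoly (ρ σ : YoungDiagram) : IsPoly fun x => skewContPoly x ρ σ := by
  refine ⟨∏ c ∈ ρ.cells \ σ.cells, (Polynomial.X + Polynomial.C (c.2 : ℚ) - Polynomial.C (c.1 : ℚ)),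
    fun x => ?_⟩
  simp [skewContPoly, Polynomial.eval_prod]

lemma finite_card_eq (N : ℕ) : {ρ : YoungDiagram | ρ.card = N}.Finite := by
  have hinj : Function.Injective YoungDiagram.cells := fun a b h => YoungDiagram.ext h
  refine (Set.Finite.preimage hinj.injOn
    (Finset.finite_toSet (Finset.range N ×ˢ Finset.range N).powerset)).subset ?_
  rintro ρ rfl
  simp only [Set.mem_preimage, Finset.mem_coe, Finset.mem_powerset]
  rintro ⟨i, j⟩ hc
  have hj := YoungDiagram.mem_iff_lt_rowLen.mp hc
  have hi : i < ρ.card := by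
    by_contra h
    rw [rowLen_eq_zero (not_lt.mp h)] at hj
    omega
  have hle : ρ.rowLen i ≤ ρ.card := by
    rw [card_eq_sum ρ fun i hi => rowLen_eq_zero hi]
    exact Finset.single_le_sum (fun _ _ => Nat.zero_le _) (Finset.mem_range.mpr hi)
  rw [Finset.mem_product, Finset.mem_range, Finset.mem_range]
  exact ⟨hi, hj.trans_le hle⟩

lemma exists_P_eq_sum (lam mu : YoungDiagram) :
    ∃ (s : Finset YoungDiagram) (c : YoungDiagram → ℚ), ∀ e f, P lam mu e f = ∑ ρ ∈ s,
      c ρ * (skewContPoly (-e) ρ lam.transpose * skewContPoly f ρ mu) := by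
  refine ⟨(finite_card_eq (lam.transpose.card + mu.card)).toFinset,
    fun ρ => (-1) ^ mu.card * lrCoeff lam.transpose mu ρ / hookProd ρ, fun e f => ?_⟩
  rw [P_eq_finsum, finsum_eq_sum_of_support_subset]
  · exact Finset.sum_congr rfl fun ρ _ => by ring
  · intro ρ hρ
    rw [Set.Finite.coe_toFinset]
    refine (lrCoeff_ne_zero fun h => hρ ?_).2.2
    simp [h]

lemma isPoly_P_left (lam mu : YoungDiagram) (f : ℚ) : IsPoly fun e => P lam mu e f := by
  obtain ⟨s, c, h⟩ := exists_P_eq_sum lam mu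
  simp only [h]
  refine IsPoly.sum fun ρ _ => IsPoly.const_mul ?_ _
  have := ((isPoly_skewContPoly ρ lam.transpose).comp (-Polynomial.X)).const_mul
    (skewContPoly f ρ mu)
  simpa [mul_comm] using this

lemma isPoly_P_right (lam mu : YoungDiagram) (e : ℚ) : IsPoly fun f => P lam mu e f := by
  obtain ⟨s, c, h⟩ := exists_P_eq_sum lam mu
  simp only [h]
  exact IsPoly.sum fun ρ _ => IsPoly.const_mul ((isPoly_skewContPoly ρ mu).const_mul _) _

lemma P_recursion_of_large (lam mu : YoungDiagram) {n : ℕ}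
    (hn : lam.transpose.card + mu.card ≤ n) (p : ℕ) :
    P lam mu (-((n : ℚ) + p)) n = ∑ θ ∈ vstrip mu, P lam θ (-((n : ℚ) + (p + 1 : ℕ))) n := by
  have hmu : ∀ i, n ≤ i → mu.rowLen i = 0 := fun i hi => rowLen_eq_zero (by omega)
  obtain ⟨c, hc, h⟩ := exists_P_eq_chooseDet n
  refine mul_left_cancel₀ hc ?_
  rw [h lam mu p hn, chooseDet_recursion _ hmu, Finset.mul_sum]
  refine Finset.sum_congr rfl fun θ hθ => ?_
  have := card_add_of_mem_vstrip hθ hmu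
  rw [h lam θ (p + 1) (by omega)]
  rfl

lemma P_add_one (lam mu : YoungDiagram) (e f : ℚ) :
    P lam mu (e + 1) f = ∑ θ ∈ vstrip mu, P lam θ e f := by
  refine IsPoly.ext (isPoly_P_right lam mu (e + 1))
    (IsPoly.sum fun θ _ => isPoly_P_right lam θ e)
    (u := fun k => ((lam.transpose.card + mu.card + k : ℕ) : ℚ))
    (fun a b hab => by simpa using hab) (fun k => ?_) f
  set n := lam.transpose.card + mu.card + k with hn
  have hpoly : IsPoly fun e => P lam mu (e + 1) n := by
    obtain ⟨q, hq⟩ := isPoly_P_left lam mu n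
    exact ⟨q.comp (Polynomial.X + 1), fun x => by simp [hq (x + 1)]⟩
  refine IsPoly.ext hpoly (IsPoly.sum fun θ _ => isPoly_P_left lam θ n)
    (u := fun p => -((n : ℚ) + (p + 1 : ℕ))) (fun a b hab => by simpa using hab) (fun p => ?_) e
  have h := P_recursion_of_large lam mu (n := n) (by omega) p
  rw [← h]
  congr 1
  push_cast
  ring

end PolynomialExtension

/-- Recursion: `P_{λ,μ}(e+1,f) − P_{λ,μ}(e,f) = ∑_{μ→θ, θ≠μ} P_{λ,θ}(e,f)`,
the sum being over `θ ⊆ μ`, `θ ≠ μ`, with `μ/θ` a vertical strip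
(at most one box in each row). -/
theorem P_recursion (lam mu : YoungDiagram) (e f : ℤ) :
    P lam mu ((e : ℚ) + 1) (f : ℚ) - P lam mu (e : ℚ) (f : ℚ) =
    ∑ᶠ θ : YoungDiagram,
      if θ ≤ mu ∧ θ ≠ mu ∧ (∀ i, mu.rowLen i ≤ θ.rowLen i + 1)
      then P lam θ (e : ℚ) (f : ℚ) else 0 := by
  have hself : mu ∈ vstrip mu := mem_vstrip.mpr ⟨le_rfl, fun i => Nat.le_succ _⟩
  rw [P_add_one, ← Finset.add_sum_erase _ _ hself, add_sub_cancel_left,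
    finsum_eq_sum_of_support_subset (s := (vstrip mu).erase mu)]
  · refine Finset.sum_congr rfl fun θ hθ => ?_
    rw [Finset.mem_erase, mem_vstrip] at hθ
    rw [if_pos ⟨hθ.2.1, hθ.1, hθ.2.2⟩]
  · intro θ hθ
    rw [Finset.mem_coe, Finset.mem_erase, mem_vstrip]
    by_contra hne
    refine hθ (if_neg fun h => hne ⟨h.2.1, h.1, h.2.2⟩)

end ChernTensor
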